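/- For every real ν ≥ 0, every real ε with 0 < ε ≤ 1, and every integer s ≥ 1, one has j′_{ν,s} < j′_{ν+ε,s} < y_{ν+ε,s} and y′_{ν,s} < y′_{ν+ε,s} < j_{ν+ε,s}. -/

import Mathlib

open Real Filter

/-- Bessel function of the first kind of real order `ν`:
`J_ν(x) = Σ_{k=0}^∞ ((−1)^k / (k! · Γ(ν+k+1))) · (x/2)^{ν+2k}`. -/
noncomputable def besselJ (ν : ℝ) (x : ℝ) : ℝ :=
  ∑' k : ℕ, ((-1 : ℝ) ^ k / ((k.factorial : ℝ) * Real.Gamma (ν + k + 1))) *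
    (x / 2) ^ (ν + 2 * (k : ℝ))

/-- Bessel function of the second kind of real order `ν`, defined as the limit
`Y_ν(x) = lim_{μ→ν, μ ∉ ℤ} (J_μ(x)·cos(μπ) − J_{−μ}(x)) / sin(μπ)`. -/
noncomputable def besselY (ν : ℝ) (x : ℝ) : ℝ :=
  limUnder (nhdsWithin ν {μ : ℝ | ∀ n : ℤ, μ ≠ (n : ℝ)})
    fun μ => (besselJ μ x * Real.cos (μ * π) - besselJ (-μ) x) / Real.sin (μ * π)

/-- `z s`, for integers `s ≥ 1`, enumerates all the positive real zeros of `f`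
in strictly increasing order. -/
structure IsPosZeroSeq (f : ℝ → ℝ) (z : ℕ → ℝ) : Prop where
  pos : ∀ s, 1 ≤ s → 0 < z s
  mono : ∀ s t, 1 ≤ s → s < t → z s < z t
  isZero : ∀ s, 1 ≤ s → f (z s) = 0
  complete : ∀ x, 0 < x → f x = 0 → ∃ s, 1 ≤ s ∧ z s = x

/-- `z s`, for integers `s ≥ 1`, enumerates the zeros `j'_{ν,s}` of `J'_ν`
(increasingly), with the convention that `x = 0` is counted as the first zero
`j'_{0,1}` of `J'_0`. -/
def IsBesselJDerivZeroSeq (ν : ℝ) (z : ℕ → ℝ) : Prop :=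
  (ν = 0 → z 1 = 0 ∧ IsPosZeroSeq (deriv (besselJ 0)) fun s => z (s + 1)) ∧
  (ν ≠ 0 → IsPosZeroSeq (deriv (besselJ ν)) z)

/-- The entire part of the Bessel series: `J_ν(x) = (x/2)^ν · besselEntire ν ((x/2)^2)`. -/
noncomputable def besselEntire (ν s : ℝ) : ℝ :=
  ∑' k : ℕ, (-s) ^ k / ((k.factorial : ℝ) * Real.Gamma (ν + k + 1))

theorem exists_inv_Gamma_bound (ν : ℝ) :
    ∃ C : ℝ, 0 < C ∧ ∀ k : ℕ, |(Real.Gamma (ν + k + 1))⁻¹| ≤ C := by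
  have h : ∀ᶠ k : ℕ in atTop, |(Real.Gamma (ν + k + 1))⁻¹| ≤ 1 := by
    obtain ⟨N, hN⟩ := exists_nat_ge (1 - ν)
    filter_upwards [eventually_ge_atTop N] with k hk
    have hk' : (N : ℝ) ≤ k := by exact_mod_cast hk
    have h2 : (2 : ℝ) ≤ ν + k + 1 := by linarith
    have h1 : 1 ≤ Real.Gamma (ν + k + 1) := by
      have := Real.Gamma_strictMonoOn_Ici.monotoneOn (Set.mem_Ici.2 le_rfl) (Set.mem_Ici.2 h2) h2
      rwa [Real.Gamma_two] at this
    rw [abs_of_nonneg (by positivity)]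
    exact inv_le_one_of_one_le₀ h1
  obtain ⟨N, hN⟩ := eventually_atTop.1 h
  refine ⟨1 + ∑ k ∈ Finset.range N, |(Real.Gamma (ν + k + 1))⁻¹|, by positivity, fun k => ?_⟩
  by_cases hk : N ≤ k
  · exact (hN k hk).trans (le_add_of_nonneg_right (by positivity))
  · have := Finset.single_le_sum (f := fun k : ℕ => |(Real.Gamma (ν + k + 1))⁻¹|)
      (fun i _ => abs_nonneg _) (Finset.mem_range.2 (not_le.1 hk))
    linarith

theorem summable_besselEntire (ν s : ℝ) :
    Summable fun k : ℕ => (-s) ^ k / ((k.factorial : ℝ) * Real.Gamma (ν + k + 1)) := by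
  obtain ⟨C, hC, hb⟩ := exists_inv_Gamma_bound ν
  refine Summable.of_norm_bounded ((Real.summable_pow_div_factorial |s|).mul_right C) fun k => ?_
  rw [Real.norm_eq_abs, div_mul_eq_div_div, div_eq_mul_inv, abs_mul, abs_div, abs_pow, abs_neg,
    Nat.abs_cast]
  exact mul_le_mul_of_nonneg_left (hb k) (by positivity)

theorem hasDerivAt_besselEntire (ν s : ℝ) :
    HasDerivAt (besselEntire ν) (-besselEntire (ν + 1) s) s := by
  obtain ⟨C, hC, hb⟩ := exists_inv_Gamma_bound ν
  have key := hasDerivAt_tsum_of_isPreconnected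
    (g := fun (k : ℕ) (y : ℝ) => (-y) ^ k / ((k.factorial : ℝ) * Real.Gamma (ν + k + 1)))
    (g' := fun (k : ℕ) (y : ℝ) =>
      (k * (-y) ^ (k - 1) * (-1)) / ((k.factorial : ℝ) * Real.Gamma (ν + k + 1)))
    (u := fun k : ℕ => (k * (|s| + 1) ^ (k - 1) / (k.factorial : ℝ)) * C)
    (t := Metric.ball 0 (|s| + 1)) (y₀ := 0) (y := s) ?_ Metric.isOpen_ball
    (convex_ball _ _).isPreconnected ?_ ?_ (Metric.mem_ball_self (by positivity))
    (summable_besselEntire ν 0) (by simp [Metric.mem_ball])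
  · refine key.congr_deriv ?_
    have hs : Summable fun k : ℕ =>
        (k * (-s) ^ (k - 1) * (-1)) / ((k.factorial : ℝ) * Real.Gamma (ν + k + 1)) := by
      rw [← summable_nat_add_iff 1]
      refine ((summable_besselEntire (ν + 1) s).mul_left (-1)).congr fun k => ?_
      rw [Nat.factorial_succ]
      push_cast
      have : (k + 1 : ℝ) ≠ 0 := by positivity
      have e : ν + 1 + k + 1 = ν + (k + 1) + 1 := by ring
      rw [e, mul_assoc (k + 1 : ℝ), mul_assoc (k + 1 : ℝ), mul_div_mul_left _ _ this]
      ring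
    rw [hs.tsum_eq_zero_add, besselEntire, ← tsum_neg]
    simp only [Nat.cast_zero, zero_mul, zero_div, zero_add]
    refine tsum_congr fun k => ?_
    rw [Nat.factorial_succ]
    push_cast
    have : (k + 1 : ℝ) ≠ 0 := by positivity
    have e : ν + 1 + k + 1 = ν + (k + 1) + 1 := by ring
    rw [e, mul_assoc (k + 1 : ℝ), mul_assoc (k + 1 : ℝ), mul_div_mul_left _ _ this]
    ring
  · refine Summable.mul_right _ ?_
    rw [← summable_nat_add_iff 1]
    refine (Real.summable_pow_div_factorial (|s| + 1)).congr fun k => ?_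
    rw [Nat.factorial_succ]
    push_cast
    have : (k + 1 : ℝ) ≠ 0 := by positivity
    rw [mul_div_mul_left _ _ this]
  · intro k y _
    have h := ((hasDerivAt_neg y).pow k).div_const ((k.factorial : ℝ) * Real.Gamma (ν + k + 1))
    exact h
  · intro k y hy
    have hy' : |y| ≤ |s| + 1 := by
      rw [Metric.mem_ball, dist_zero_right, Real.norm_eq_abs] at hy
      exact hy.le
    rw [Real.norm_eq_abs, div_mul_eq_div_div, div_eq_mul_inv, abs_mul, abs_div, abs_mul, abs_mul,
      abs_pow, abs_neg, abs_neg, abs_one, mul_one, Nat.abs_cast, Nat.abs_cast]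
    gcongr
    exact hb k

theorem besselEntire_sub_one (ν s : ℝ) :
    besselEntire (ν - 1) s = ν * besselEntire ν s - s * besselEntire (ν + 1) s := by
  have h1 := summable_besselEntire ν s
  have h2 : s * besselEntire (ν + 1) s =
      ∑' k : ℕ, -(k * ((-s) ^ k / ((k.factorial : ℝ) * Real.Gamma (ν + k + 1)))) := by
    have hs : Summable fun k : ℕ =>
        -(k * ((-s) ^ k / ((k.factorial : ℝ) * Real.Gamma (ν + k + 1)))) := by
      rw [← summable_nat_add_iff 1]
      refine ((summable_besselEntire (ν + 1) s).mul_left s).congr fun k => ?_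
      rw [Nat.factorial_succ]
      push_cast
      have : (k + 1 : ℝ) ≠ 0 := by positivity
      have e : ν + 1 + k + 1 = ν + (k + 1) + 1 := by ring
      rw [e, mul_assoc (k + 1 : ℝ), ← mul_div_assoc (k + 1 : ℝ), mul_div_mul_left _ _ this]
      ring
    rw [hs.tsum_eq_zero_add, besselEntire, ← tsum_mul_left]
    simp only [Nat.cast_zero, zero_mul, neg_zero, zero_add]
    refine tsum_congr fun k => ?_
    rw [Nat.factorial_succ]
    push_cast
    have : (k + 1 : ℝ) ≠ 0 := by positivity
    have e : ν + 1 + k + 1 = ν + (k + 1) + 1 := by ring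
    rw [e, mul_assoc (k + 1 : ℝ), ← mul_div_assoc (k + 1 : ℝ), mul_div_mul_left _ _ this]
    ring
  have hs : Summable fun k : ℕ =>
        -(k * ((-s) ^ k / ((k.factorial : ℝ) * Real.Gamma (ν + k + 1)))) := by
    rw [← summable_nat_add_iff 1]
    refine ((summable_besselEntire (ν + 1) s).mul_left s).congr fun k => ?_
    rw [Nat.factorial_succ]
    push_cast
    have : (k + 1 : ℝ) ≠ 0 := by positivity
    have e : ν + 1 + k + 1 = ν + (k + 1) + 1 := by ring
    rw [e, mul_assoc (k + 1 : ℝ), ← mul_div_assoc (k + 1 : ℝ), mul_div_mul_left _ _ this]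
    ring
  rw [h2]
  unfold besselEntire
  rw [← tsum_mul_left, ← (h1.mul_left ν).tsum_sub hs]
  refine tsum_congr fun k => ?_
  rw [sub_neg_eq_add, ← add_mul]
  have e : ν - 1 + k + 1 = ν + k := by ring
  rw [e]
  by_cases h0 : ν + k = 0
  · rw [h0]
    simp
  · rw [Real.Gamma_add_one h0]
    by_cases hG : Real.Gamma (ν + k) = 0
    · simp [hG]
    · field_simp

theorem continuous_besselEntire (ν : ℝ) : Continuous (besselEntire ν) :=
  continuous_iff_continuousAt.2 fun s => (hasDerivAt_besselEntire ν s).continuousAt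

theorem besselEntire_zero (ν : ℝ) : besselEntire ν 0 = (Real.Gamma (ν + 1))⁻¹ := by
  rw [besselEntire, tsum_eq_single 0]
  · simp
  · intro k hk
    simp [hk]

theorem besselJ_eq (ν : ℝ) {x : ℝ} (hx : 0 < x) :
    besselJ ν x = (x / 2) ^ ν * besselEntire ν ((x / 2) ^ 2) := by
  rw [besselJ, besselEntire, ← tsum_mul_left]
  refine tsum_congr fun k => ?_
  have h : (x / 2) ^ (ν + 2 * (k : ℝ)) = (x / 2) ^ ν * ((x / 2) ^ 2) ^ k := by
    rw [Real.rpow_add (by positivity), ← pow_mul, ← Real.rpow_natCast (x / 2) (2 * k)]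
    push_cast
    rfl
  rw [h, neg_pow ((x / 2) ^ 2)]
  ring

theorem hasDerivAt_besselJ (ν : ℝ) {x : ℝ} (hx : 0 < x) :
    HasDerivAt (besselJ ν) (ν / x * besselJ ν x - besselJ (ν + 1) x) x := by
  have h1 : HasDerivAt (fun y : ℝ => (y / 2) ^ ν) (ν * (x / 2) ^ (ν - 1) * (1 / 2)) x := by
    have h := ((hasDerivAt_id x).div_const 2).rpow_const (p := ν) (Or.inl (by simp; positivity))
    refine h.congr_deriv ?_
    simp
    ring
  have h2 : HasDerivAt (fun y : ℝ => besselEntire ν ((y / 2) ^ 2))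
      (-besselEntire (ν + 1) ((x / 2) ^ 2) * (x / 2)) x := by
    have h := (hasDerivAt_besselEntire ν ((x / 2) ^ 2)).comp x
      (((hasDerivAt_id x).div_const 2).pow 2)
    refine h.congr_deriv ?_
    simp only [id, Nat.cast_ofNat]
    ring
  have h3 := (h1.mul h2).congr_of_eventuallyEq
    (f₁ := besselJ ν) (by
      filter_upwards [eventually_gt_nhds hx] with y hy
      exact besselJ_eq ν hy)
  refine h3.congr_deriv ?_
  rw [besselJ_eq ν hx, besselJ_eq (ν + 1) hx, Real.rpow_sub (by positivity),
    Real.rpow_add (by positivity), Real.rpow_one]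
  field_simp
  ring

theorem besselJ_sub_one (ν : ℝ) {x : ℝ} (hx : 0 < x) :
    besselJ (ν - 1) x = 2 * ν / x * besselJ ν x - besselJ (ν + 1) x := by
  rw [besselJ_eq (ν - 1) hx, besselJ_eq ν hx, besselJ_eq (ν + 1) hx, besselEntire_sub_one,
    Real.rpow_sub (by positivity), Real.rpow_add (by positivity), Real.rpow_one]
  field_simp

/-- The oscillating part of Schläfli's integral for the Hankel function. -/
noncomputable def schlafliOsc (ν x : ℝ) : ℂ :=
  ∫ θ in (0 : ℝ)..π, Complex.exp (Complex.I * (x * Real.sin θ - ν * θ : ℝ))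

/-- The decaying part of Schläfli's integral for the Hankel function. -/
noncomputable def schlafliExp (ν x : ℝ) : ℝ :=
  ∫ t in Set.Ioi (0 : ℝ), Real.exp (ν * t - x * Real.sinh t)

theorem hasDerivAt_cexp_I_mul {f : ℝ → ℝ} {f' t : ℝ} (hf : HasDerivAt f f' t) :
    HasDerivAt (fun t => Complex.exp (Complex.I * (f t : ℝ)))
      (Complex.I * f' * Complex.exp (Complex.I * (f t : ℝ))) t := by
  have h := ((hf.ofReal_comp).const_mul Complex.I).cexp
  refine h.congr_deriv ?_
  ring

theorem intervalIntegrable_schlafliOsc (ν x a b : ℝ) :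
    IntervalIntegrable
      (fun θ => Complex.exp (Complex.I * (x * Real.sin θ - ν * θ : ℝ))) MeasureTheory.volume a b :=
  (by fun_prop : Continuous fun θ =>
    Complex.exp (Complex.I * (x * Real.sin θ - ν * θ : ℝ))).intervalIntegrable _ _

theorem continuous_schlafliOsc (x : ℝ) : Continuous fun ν => schlafliOsc ν x := by
  unfold schlafliOsc
  apply intervalIntegral.continuous_parametric_intervalIntegral_of_continuous'
  simp only [Function.uncurry_def]
  fun_prop

theorem cexp_shift_sub (x ν θ : ℝ) :
    Complex.exp (Complex.I * (x * Real.sin θ - (ν - 1) * θ : ℝ)) =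
      Complex.exp (Complex.I * (x * Real.sin θ - ν * θ : ℝ)) * Complex.exp (θ * Complex.I) := by
  rw [← Complex.exp_add]
  congr 1
  push_cast
  ring

theorem cexp_shift_add (x ν θ : ℝ) :
    Complex.exp (Complex.I * (x * Real.sin θ - (ν + 1) * θ : ℝ)) =
      Complex.exp (Complex.I * (x * Real.sin θ - ν * θ : ℝ)) * Complex.exp (-θ * Complex.I) := by
  rw [← Complex.exp_add]
  congr 1
  push_cast
  ring

theorem hasDerivAt_schlafliOsc (ν x : ℝ) :
    HasDerivAt (schlafliOsc ν) ((schlafliOsc (ν - 1) x - schlafliOsc (ν + 1) x) / 2) x := by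
  have h := intervalIntegral.hasDerivAt_integral_of_dominated_loc_of_deriv_le
    (μ := MeasureTheory.volume) (a := 0) (b := π) (s := Set.univ) (x₀ := x) (bound := fun _ => 1)
    (F := fun (x θ : ℝ) => Complex.exp (Complex.I * (x * Real.sin θ - ν * θ : ℝ)))
    (F' := fun (x θ : ℝ) => Complex.I * (Real.sin θ : ℝ) *
      Complex.exp (Complex.I * (x * Real.sin θ - ν * θ : ℝ)))
    Filter.univ_mem ?_ (intervalIntegrable_schlafliOsc ν x 0 π) ?_ ?_ ?_ ?_
  · refine h.2.congr_deriv ?_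
    rw [schlafliOsc, schlafliOsc, ← intervalIntegral.integral_sub
      (intervalIntegrable_schlafliOsc _ _ _ _) (intervalIntegrable_schlafliOsc _ _ _ _),
      ← intervalIntegral.integral_div]
    refine intervalIntegral.integral_congr fun θ _ => ?_
    rw [cexp_shift_sub, cexp_shift_add, Complex.ofReal_sin, Complex.sin]
    ring_nf
    rw [Complex.I_sq]
    ring
  · exact Filter.Eventually.of_forall fun y =>
      (by fun_prop : Continuous _).aestronglyMeasurable
  · exact (by fun_prop : Continuous _).aestronglyMeasurable
  · refine MeasureTheory.ae_of_all _ fun θ _ y _ => ?_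
    rw [norm_mul, norm_mul, Complex.norm_I, Complex.norm_exp_I_mul_ofReal, Complex.norm_real,
      one_mul, mul_one]
    exact Real.abs_sin_le_one θ
  · exact intervalIntegrable_const
  · refine MeasureTheory.ae_of_all _ fun θ _ y _ => ?_
    refine hasDerivAt_cexp_I_mul ?_
    simpa using ((hasDerivAt_id y).mul_const (Real.sin θ)).sub_const (ν * θ)

theorem schlafliOsc_recurrence (ν x : ℝ) :
    x / 2 * (schlafliOsc (ν - 1) x + schlafliOsc (ν + 1) x) =
      ν * schlafliOsc ν x - Complex.I * (Complex.exp (-(ν * π * Complex.I)) - 1) := by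
  have hd : ∀ θ ∈ Set.uIcc 0 π, HasDerivAt
      (fun θ : ℝ => Complex.exp (Complex.I * (x * Real.sin θ - ν * θ : ℝ)))
      (Complex.I * (x * Real.cos θ - ν : ℝ) *
        Complex.exp (Complex.I * (x * Real.sin θ - ν * θ : ℝ))) θ := fun θ _ => by
    refine hasDerivAt_cexp_I_mul ?_
    exact (((Real.hasDerivAt_sin θ).const_mul x).sub
      ((hasDerivAt_id θ).const_mul ν)).congr_deriv (by rw [mul_one])
  have h := intervalIntegral.integral_eq_sub_of_hasDerivAt hd
    ((by fun_prop : Continuous fun θ : ℝ => Complex.I * (x * Real.cos θ - ν : ℝ) *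
      Complex.exp (Complex.I * (x * Real.sin θ - ν * θ : ℝ))).intervalIntegrable 0 π)
  have h2 : (∫ θ in (0 : ℝ)..π, Complex.I * (x * Real.cos θ - ν : ℝ) *
        Complex.exp (Complex.I * (x * Real.sin θ - ν * θ : ℝ))) =
      Complex.I * (x / 2 * (schlafliOsc (ν - 1) x + schlafliOsc (ν + 1) x)
        - ν * schlafliOsc ν x) := by
    rw [schlafliOsc, schlafliOsc, schlafliOsc, ← intervalIntegral.integral_add
      (intervalIntegrable_schlafliOsc _ _ _ _) (intervalIntegrable_schlafliOsc _ _ _ _),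
      ← intervalIntegral.integral_const_mul, ← intervalIntegral.integral_const_mul,
      ← intervalIntegral.integral_sub, ← intervalIntegral.integral_const_mul]
    · refine intervalIntegral.integral_congr fun θ _ => ?_
      rw [cexp_shift_sub, cexp_shift_add]
      push_cast
      rw [Complex.cos]
      ring
    · exact ((intervalIntegrable_schlafliOsc _ _ _ _).add
        (intervalIntegrable_schlafliOsc _ _ _ _)).const_mul _
    · exact (intervalIntegrable_schlafliOsc _ _ _ _).const_mul _
  rw [h2] at h
  have e0 : Complex.exp (Complex.I * (x * Real.sin 0 - ν * 0 : ℝ)) = 1 := by simp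
  have e1 : Complex.exp (Complex.I * (x * Real.sin π - ν * π : ℝ)) =
      Complex.exp (-(ν * π * Complex.I)) := by
    congr 1
    simp
    ring
  rw [e0, e1] at h
  linear_combination (-Complex.I) * h +
    (x / 2 * (schlafliOsc (ν - 1) x + schlafliOsc (ν + 1) x) - ν * schlafliOsc ν x) *
      Complex.I_sq

theorem schlafliOsc_neg (ν x : ℝ) :
    schlafliOsc (-ν) x = Complex.exp (ν * π * Complex.I) * schlafliOsc ν x := by
  have h := intervalIntegral.integral_comp_sub_left (a := 0) (b := π)
    (fun θ => Complex.exp (Complex.I * (x * Real.sin θ - -ν * θ : ℝ))) π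
  rw [sub_self, sub_zero] at h
  rw [schlafliOsc, schlafliOsc, ← intervalIntegral.integral_const_mul, ← h]
  refine intervalIntegral.integral_congr fun θ _ => ?_
  rw [Real.sin_pi_sub, ← Complex.exp_add]
  congr 1
  push_cast
  ring

theorem sinh_lower_bound {t : ℝ} (ht : 0 ≤ t) : t ^ 2 / 4 ≤ Real.sinh t := by
  rw [Real.sinh_eq]
  have h1 := Real.quadratic_le_exp_of_nonneg ht
  have h2 : Real.exp (-t) ≤ 1 := Real.exp_le_one_iff.2 (by linarith)
  linarith

theorem exp_schlafliExp_le {ν x N x₀ t : ℝ} (hν : ν ≤ N) (hx₀ : 0 < x₀) (hx : x₀ ≤ x)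
    (ht : 0 ≤ t) :
    Real.exp (ν * t - x * Real.sinh t) ≤ Real.exp ((N + 1) ^ 2 / x₀) * Real.exp (-1 * t) := by
  rw [← Real.exp_add]
  refine Real.exp_le_exp.2 ?_
  have h1 : x₀ * (t ^ 2 / 4) ≤ x * Real.sinh t :=
    mul_le_mul hx (sinh_lower_bound ht) (by positivity) (by linarith)
  have h2 : ν * t ≤ N * t := mul_le_mul_of_nonneg_right hν ht
  have h3 : (N + 1) * t - x₀ * (t ^ 2 / 4) ≤ (N + 1) ^ 2 / x₀ := by
    rw [le_div_iff₀ hx₀]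
    nlinarith [sq_nonneg (x₀ * t / 2 - (N + 1))]
  linarith

theorem integrableOn_exp_neg_mul (C : ℝ) {a : ℝ} (ha : 0 < a) :
    MeasureTheory.IntegrableOn (fun t : ℝ => C * Real.exp (-a * t)) (Set.Ioi 0) :=
  (integrableOn_exp_mul_Ioi (neg_lt_zero.2 ha) 0).const_mul C

theorem integrableOn_schlafliExp (ν : ℝ) {x : ℝ} (hx : 0 < x) :
    MeasureTheory.IntegrableOn (fun t => Real.exp (ν * t - x * Real.sinh t)) (Set.Ioi 0) := by
  refine (integrableOn_exp_neg_mul (Real.exp ((ν + 1) ^ 2 / x)) one_pos).mono'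
    (by fun_prop : Continuous _).aestronglyMeasurable ?_
  refine (MeasureTheory.ae_restrict_mem measurableSet_Ioi).mono fun t ht => ?_
  rw [Real.norm_eq_abs, Real.abs_exp]
  exact exp_schlafliExp_le le_rfl hx le_rfl (le_of_lt ht)

theorem continuous_schlafliExp {x : ℝ} (hx : 0 < x) : Continuous fun ν => schlafliExp ν x := by
  refine continuous_iff_continuousAt.2 fun ν => ?_
  refine MeasureTheory.continuousAt_of_dominated
    (bound := fun t => Real.exp ((ν + 1 + 1) ^ 2 / x) * Real.exp (-1 * t)) ?_ ?_ ?_ ?_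
  · exact Filter.Eventually.of_forall fun y => (by fun_prop : Continuous _).aestronglyMeasurable
  · filter_upwards [eventually_lt_nhds (lt_add_one ν)] with μ hμ
    refine (MeasureTheory.ae_restrict_mem measurableSet_Ioi).mono fun t ht => ?_
    rw [Real.norm_eq_abs, Real.abs_exp]
    exact exp_schlafliExp_le hμ.le hx le_rfl (le_of_lt ht)
  · exact integrableOn_exp_neg_mul _ one_pos
  · exact MeasureTheory.ae_of_all _ fun t => (by fun_prop : Continuous _).continuousAt

theorem exp_shift_sub (x ν t : ℝ) :
    Real.exp ((ν - 1) * t - x * Real.sinh t) =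
      Real.exp (ν * t - x * Real.sinh t) * Real.exp (-t) := by
  rw [← Real.exp_add]
  ring_nf

theorem exp_shift_add (x ν t : ℝ) :
    Real.exp ((ν + 1) * t - x * Real.sinh t) =
      Real.exp (ν * t - x * Real.sinh t) * Real.exp t := by
  rw [← Real.exp_add]
  ring_nf

theorem hasDerivAt_schlafliExp (ν : ℝ) {x : ℝ} (hx : 0 < x) :
    HasDerivAt (schlafliExp ν) ((schlafliExp (ν - 1) x - schlafliExp (ν + 1) x) / 2) x := by
  have h := hasDerivAt_integral_of_dominated_loc_of_deriv_le
    (μ := MeasureTheory.volume.restrict (Set.Ioi 0)) (s := Set.Ioi (x / 2)) (x₀ := x)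
    (bound := fun t => Real.exp ((ν + 1) * t - (x / 2) * Real.sinh t))
    (F := fun (x t : ℝ) => Real.exp (ν * t - x * Real.sinh t))
    (F' := fun (x t : ℝ) => -Real.sinh t * Real.exp (ν * t - x * Real.sinh t))
    (Ioi_mem_nhds (by linarith)) ?_ (integrableOn_schlafliExp ν hx) ?_ ?_ ?_ ?_
  · refine h.2.congr_deriv ?_
    rw [schlafliExp, schlafliExp, ← MeasureTheory.integral_sub
      (integrableOn_schlafliExp _ hx) (integrableOn_schlafliExp _ hx),
      ← MeasureTheory.integral_div]
    refine MeasureTheory.integral_congr_ae (MeasureTheory.ae_of_all _ fun t => ?_)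
    simp only
    rw [exp_shift_sub, exp_shift_add, Real.sinh_eq]
    ring
  · exact Filter.Eventually.of_forall fun y => (by fun_prop : Continuous _).aestronglyMeasurable
  · exact (by fun_prop : Continuous _).aestronglyMeasurable
  · refine (MeasureTheory.ae_restrict_mem measurableSet_Ioi).mono fun t ht y hy => ?_
    have ht' : 0 < t := ht
    have hy' : x / 2 < y := hy
    have hs : 0 < Real.sinh t := Real.sinh_pos_iff.2 ht
    rw [norm_mul, norm_neg, Real.norm_eq_abs, Real.norm_eq_abs, Real.abs_exp, abs_of_pos hs,
      exp_shift_add, mul_comm]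
    have h1 : Real.sinh t ≤ Real.exp t := by
      rw [Real.sinh_eq]
      linarith [Real.exp_pos t, Real.exp_pos (-t)]
    gcongr
  · exact integrableOn_schlafliExp _ (by linarith)
  · refine MeasureTheory.ae_of_all _ fun t y _ => ?_
    have h := (((hasDerivAt_id y).mul_const (Real.sinh t)).const_sub (ν * t)).exp
    refine h.congr_deriv ?_
    simp only [id, one_mul]
    ring

theorem schlafliExp_recurrence (ν : ℝ) {x : ℝ} (hx : 0 < x) :
    x / 2 * (schlafliExp (ν - 1) x + schlafliExp (ν + 1) x) = 1 + ν * schlafliExp ν x := by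
  have hd : ∀ t ∈ Set.Ici (0 : ℝ), HasDerivAt (fun t => Real.exp (ν * t - x * Real.sinh t))
      (ν * Real.exp (ν * t - x * Real.sinh t) - x / 2 *
        (Real.exp ((ν - 1) * t - x * Real.sinh t) + Real.exp ((ν + 1) * t - x * Real.sinh t)))
      t := fun t _ => by
    have h := (((hasDerivAt_id t).const_mul ν).sub ((Real.hasDerivAt_sinh t).const_mul x)).exp
    refine h.congr_deriv ?_
    rw [exp_shift_sub, exp_shift_add, Real.cosh_eq]
    simp only [id, Pi.sub_apply]
    ring
  have hi : MeasureTheory.IntegrableOn (fun t => Real.exp ((ν - 1) * t - x * Real.sinh t) +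
      Real.exp ((ν + 1) * t - x * Real.sinh t)) (Set.Ioi 0) :=
    ((integrableOn_schlafliExp (ν - 1) hx).add (integrableOn_schlafliExp (ν + 1) hx))
  have hi0 := (integrableOn_schlafliExp ν hx)
  have hlim : Tendsto (fun t => Real.exp (ν * t - x * Real.sinh t)) atTop (nhds 0) := by
    have h0 : Tendsto (fun t : ℝ => Real.exp ((ν + 1) ^ 2 / x) * Real.exp (-1 * t)) atTop
        (nhds 0) := by
      have := (Real.tendsto_exp_atBot.comp
        (tendsto_id.const_mul_atTop_of_neg (by norm_num : (-1 : ℝ) < 0))).const_mul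
          (Real.exp ((ν + 1) ^ 2 / x))
      simpa using this
    refine squeeze_zero' (Filter.Eventually.of_forall fun t => (Real.exp_pos _).le) ?_ h0
    filter_upwards [eventually_ge_atTop 0] with t ht
    exact exp_schlafliExp_le le_rfl hx le_rfl ht
  have h := MeasureTheory.integral_Ioi_of_hasDerivAt_of_tendsto' hd
    ((hi0.const_mul ν).sub (hi.const_mul (x / 2))) hlim
  rw [MeasureTheory.integral_sub (hi0.const_mul ν) (hi.const_mul (x / 2)),
    MeasureTheory.integral_const_mul, MeasureTheory.integral_const_mul,
    MeasureTheory.integral_add (integrableOn_schlafliExp (ν - 1) hx)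
      (integrableOn_schlafliExp (ν + 1) hx)] at h
  simp only [mul_zero, Real.sinh_zero, sub_zero, Real.exp_zero] at h
  rw [schlafliExp, schlafliExp, schlafliExp]
  linarith

theorem schlafliExp_nonneg (ν x : ℝ) : 0 ≤ schlafliExp ν x :=
  MeasureTheory.integral_nonneg fun _ => (Real.exp_pos _).le

theorem schlafliExp_le (ν : ℝ) {x : ℝ} (hx : 0 < x) (h : ν < x) :
    schlafliExp ν x ≤ 1 / (x - ν) := by
  have hpos : 0 < x - ν := by linarith
  have h2 : ∫ t in Set.Ioi (0 : ℝ), 1 * Real.exp (-(x - ν) * t) = 1 / (x - ν) := by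
    simp only [one_mul]
    rw [integral_exp_mul_Ioi (by linarith) 0]
    rw [mul_zero, Real.exp_zero, neg_div_neg_eq]
  rw [← h2]
  refine MeasureTheory.setIntegral_mono_on (integrableOn_schlafliExp ν hx)
    (integrableOn_exp_neg_mul 1 hpos) measurableSet_Ioi fun t ht => ?_
  rw [one_mul]
  refine Real.exp_le_exp.2 ?_
  have h3 : t ≤ Real.sinh t := Real.self_le_sinh_iff.2 (le_of_lt ht)
  nlinarith

theorem le_of_hasDerivAt_nonneg {f f' : ℝ → ℝ} {a b : ℝ} (hab : a ≤ b)
    (hf : ∀ x ∈ Set.Icc a b, HasDerivAt f (f' x) x) (h0 : ∀ x ∈ Set.Ioo a b, 0 ≤ f' x) :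
    f a ≤ f b := by
  refine monotoneOn_of_hasDerivWithinAt_nonneg (f' := f') (convex_Icc a b)
    (fun x hx => (hf x hx).continuousAt.continuousWithinAt) ?_ ?_
    (Set.left_mem_Icc.2 hab) (Set.right_mem_Icc.2 hab) hab
  · intro x hx
    exact (hf x (interior_subset hx)).hasDerivWithinAt
  · intro x hx
    rw [interior_Icc] at hx
    exact h0 x hx

theorem lt_of_hasDerivAt_pos {f f' : ℝ → ℝ} {a b : ℝ} (hab : a < b)
    (hf : ∀ x ∈ Set.Icc a b, HasDerivAt f (f' x) x) (h0 : ∀ x ∈ Set.Ioo a b, 0 < f' x) :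
    f a < f b := by
  refine strictMonoOn_of_hasDerivWithinAt_pos (f' := f') (convex_Icc a b)
    (fun x hx => (hf x hx).continuousAt.continuousWithinAt) ?_ ?_
    (Set.left_mem_Icc.2 hab.le) (Set.right_mem_Icc.2 hab.le) hab
  · intro x hx
    exact (hf x (interior_subset hx)).hasDerivWithinAt
  · intro x hx
    rw [interior_Icc] at hx
    exact h0 x hx

theorem eq_of_hasDerivAt_zero {f : ℝ → ℝ} (hf : ∀ x, 0 < x → HasDerivAt f 0 x) {x y : ℝ}
    (hx : 0 < x) (hy : 0 < y) : f x = f y := by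
  have h : ∀ a b : ℝ, 0 < a → a ≤ b → f a = f b := fun a b ha hab => by
    have h1 := le_of_hasDerivAt_nonneg (f := f) (f' := fun _ => 0) hab
      (fun x hx => hf x (ha.trans_le hx.1)) fun _ _ => le_rfl
    have h2 := le_of_hasDerivAt_nonneg (f := fun x => -f x) (f' := fun _ => -0) hab
      (fun x hx => (hf x (ha.trans_le hx.1)).neg) fun _ _ => by simp
    linarith
  rcases le_total x y with hxy | hxy
  · exact h x y hx hxy
  · exact (h y x hy hxy).symm

/-- The Bessel equation of order `ν` on `(0, ∞)` as a first-order system for `u` and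
`w = x u'`. -/
structure IsBesselSol (ν : ℝ) (u w : ℝ → ℝ) : Prop where
  hasDerivAt_fst : ∀ x, 0 < x → HasDerivAt u (w x / x) x
  hasDerivAt_snd : ∀ x, 0 < x → HasDerivAt w (-(x - ν ^ 2 / x) * u x) x

namespace IsBesselSol

variable {ν : ℝ} {u w v z : ℝ → ℝ}

theorem comb (h : IsBesselSol ν u w) (h' : IsBesselSol ν v z) (c d : ℝ) :
    IsBesselSol ν (fun x => c * u x + d * v x) (fun x => c * w x + d * z x) where
  hasDerivAt_fst x hx :=
    (((h.hasDerivAt_fst x hx).const_mul c).add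
      ((h'.hasDerivAt_fst x hx).const_mul d)).congr_deriv (by ring)
  hasDerivAt_snd x hx :=
    (((h.hasDerivAt_snd x hx).const_mul c).add
      ((h'.hasDerivAt_snd x hx).const_mul d)).congr_deriv (by ring)

theorem hasDerivAt_wronskian (h : IsBesselSol ν u w) (h' : IsBesselSol ν v z) {x : ℝ}
    (hx : 0 < x) : HasDerivAt (fun x => u x * z x - w x * v x) 0 x :=
  (((h.hasDerivAt_fst x hx).mul (h'.hasDerivAt_snd x hx)).sub
    ((h.hasDerivAt_snd x hx).mul (h'.hasDerivAt_fst x hx))).congr_deriv (by ring)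

theorem eq_zero_of_initial (h : IsBesselSol ν u w) {a : ℝ} (ha : 0 < a) (hu : u a = 0)
    (hw : w a = 0) {x : ℝ} (hx : 0 < x) : u x = 0 := by
  have hm : ∀ y : ℝ, 0 < y → HasDerivAt (fun y => (1 + ν ^ 2) * Real.log y + y ^ 2 / 2)
      ((1 + ν ^ 2) / y + y) y := fun y hy => by
    refine (((Real.hasDerivAt_log hy.ne').const_mul (1 + ν ^ 2)).add
      (((hasDerivAt_pow 2 y)).div_const 2)).congr_deriv ?_
    simp
    ring
  have hE : ∀ y : ℝ, 0 < y → HasDerivAt (fun y => u y ^ 2 + w y ^ 2)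
      (2 * u y * w y * ((1 + ν ^ 2) / y - y)) y := fun y hy => by
    refine (((h.hasDerivAt_fst y hy).pow 2).add
      ((h.hasDerivAt_snd y hy).pow 2)).congr_deriv ?_
    simp
    ring
  have key : ∀ y : ℝ, 0 < y → |2 * u y * w y * ((1 + ν ^ 2) / y - y)| ≤
      (u y ^ 2 + w y ^ 2) * ((1 + ν ^ 2) / y + y) := fun y hy => by
    rw [abs_mul]
    have h1 : |2 * u y * w y| ≤ u y ^ 2 + w y ^ 2 :=
      abs_le.2 ⟨by nlinarith [sq_nonneg (u y + w y)], by nlinarith [sq_nonneg (u y - w y)]⟩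
    have h2 : |(1 + ν ^ 2) / y - y| ≤ (1 + ν ^ 2) / y + y := by
      have : 0 < (1 + ν ^ 2) / y := by positivity
      exact abs_le.2 ⟨by linarith, by linarith⟩
    exact mul_le_mul h1 h2 (abs_nonneg _) (by positivity)
  have hE0 : u a ^ 2 + w a ^ 2 = 0 := by rw [hu, hw]; norm_num
  have hle : (u x ^ 2 + w x ^ 2) ≤ 0 := by
    rcases le_total a x with hax | hxa
    · have := le_of_hasDerivAt_nonneg (f := fun y => -((u y ^ 2 + w y ^ 2) *
          Real.exp (-((1 + ν ^ 2) * Real.log y + y ^ 2 / 2)))) hax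
          (fun y hy => ((hE y (ha.trans_le hy.1)).mul (hm y (ha.trans_le hy.1)).neg.exp).neg)
          fun y hy => by
            have hy0 : 0 < y := ha.trans hy.1
            have := (abs_le.1 (key y hy0)).2
            have he := Real.exp_pos (-((1 + ν ^ 2) * Real.log y + y ^ 2 / 2))
            simp only [Pi.neg_apply]
            nlinarith
      simp only [hE0] at this
      have he := Real.exp_pos (-((1 + ν ^ 2) * Real.log x + x ^ 2 / 2))
      nlinarith
    · have := le_of_hasDerivAt_nonneg (f := fun y => ((u y ^ 2 + w y ^ 2) *
          Real.exp (((1 + ν ^ 2) * Real.log y + y ^ 2 / 2)))) hxa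
          (fun y hy => ((hE y (hx.trans_le hy.1)).mul (hm y (hx.trans_le hy.1)).exp))
          fun y hy => by
            have hy0 : 0 < y := hx.trans hy.1
            have := (abs_le.1 (key y hy0)).1
            have he := Real.exp_pos (((1 + ν ^ 2) * Real.log y + y ^ 2 / 2))
            nlinarith
      simp only [hE0] at this
      have he := Real.exp_pos (((1 + ν ^ 2) * Real.log x + x ^ 2 / 2))
      nlinarith
  nlinarith [sq_nonneg (u x), sq_nonneg (w x)]

end IsBesselSol

/-- Families satisfying the standard recurrence relations of cylinder functions. -/
structure IsCylinderFamily (F : ℝ → ℝ → ℝ) : Prop where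
  hasDerivAt : ∀ ν x, 0 < x → HasDerivAt (F ν) (ν / x * F ν x - F (ν + 1) x) x
  sub_one : ∀ ν x, 0 < x → F (ν - 1) x = 2 * ν / x * F ν x - F (ν + 1) x

theorem IsCylinderFamily.isBesselSol {F : ℝ → ℝ → ℝ} (hF : IsCylinderFamily F) (ν : ℝ) :
    IsBesselSol ν (F ν) (fun x => ν * F ν x - x * F (ν + 1) x) where
  hasDerivAt_fst x hx := (hF.hasDerivAt ν x hx).congr_deriv (by field_simp)
  hasDerivAt_snd x hx := by
    refine (((hF.hasDerivAt ν x hx).const_mul ν).sub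
      ((hasDerivAt_id x).mul (hF.hasDerivAt (ν + 1) x hx))).congr_deriv ?_
    have h := hF.sub_one (ν + 1) x hx
    rw [add_sub_cancel_right] at h
    have h' : F (ν + 1 + 1) x = 2 * (ν + 1) / x * F (ν + 1) x - F ν x := by linarith
    rw [h']
    simp only [id]
    field_simp
    ring

theorem isCylinderFamily_besselJ : IsCylinderFamily besselJ where
  hasDerivAt ν _ hx := hasDerivAt_besselJ ν hx
  sub_one ν _ hx := besselJ_sub_one ν hx

/-- The Hankel function `J_ν + i Y_ν`, via Schläfli's integrals. -/
noncomputable def hankelFn (ν x : ℝ) : ℂ :=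
  (schlafliOsc ν x - Complex.I * (schlafliExp ν x +
    Complex.exp (-(ν * π * Complex.I)) * schlafliExp (-ν) x)) / π

theorem cexp_neg_add_one (ν : ℝ) : Complex.exp (-((ν + 1 : ℝ) * π * Complex.I)) =
    -Complex.exp (-(ν * π * Complex.I)) := by
  have : -((ν + 1 : ℝ) * π * Complex.I) = -(ν * π * Complex.I) + -(π * Complex.I) := by
    push_cast
    ring
  rw [this, Complex.exp_add, Complex.exp_neg (π * Complex.I), Complex.exp_pi_mul_I]
  norm_num

theorem cexp_neg_sub_one (ν : ℝ) : Complex.exp (-((ν - 1 : ℝ) * π * Complex.I)) =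
    -Complex.exp (-(ν * π * Complex.I)) := by
  have h := cexp_neg_add_one (ν - 1)
  rw [sub_add_cancel] at h
  rw [h, neg_neg]

theorem hasDerivAt_hankelFn (ν : ℝ) {x : ℝ} (hx : 0 < x) :
    HasDerivAt (hankelFn ν) ((hankelFn (ν - 1) x - hankelFn (ν + 1) x) / 2) x := by
  have h1 := (hasDerivAt_schlafliExp ν hx).ofReal_comp
  have h2 := (hasDerivAt_schlafliExp (-ν) hx).ofReal_comp
  have h := ((hasDerivAt_schlafliOsc ν x).sub ((h1.add
    (h2.const_mul (Complex.exp (-(ν * π * Complex.I))))).const_mul Complex.I)).div_const (π : ℂ)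
  refine h.congr_deriv ?_
  unfold hankelFn
  rw [cexp_neg_add_one, cexp_neg_sub_one, neg_sub, neg_add, ← sub_eq_add_neg, ← neg_add_eq_sub ν 1]
  push_cast
  ring

theorem hankelFn_recurrence (ν : ℝ) {x : ℝ} (hx : 0 < x) :
    x / 2 * (hankelFn (ν - 1) x + hankelFn (ν + 1) x) = ν * hankelFn ν x := by
  have h1 := schlafliOsc_recurrence ν x
  have h2 : (x / 2 * (schlafliExp (ν - 1) x + schlafliExp (ν + 1) x) : ℂ) =
      1 + ν * schlafliExp ν x := by exact_mod_cast schlafliExp_recurrence ν hx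
  have h3 : (x / 2 * (schlafliExp (-ν - 1) x + schlafliExp (-ν + 1) x) : ℂ) =
      1 + -ν * schlafliExp (-ν) x := by exact_mod_cast schlafliExp_recurrence (-ν) hx
  unfold hankelFn
  rw [cexp_neg_add_one, cexp_neg_sub_one, neg_sub, neg_add, ← sub_eq_add_neg, ← neg_add_eq_sub ν 1]
  linear_combination h1 / π - Complex.I * h2 / π +
    Complex.I * Complex.exp (-(ν * π * Complex.I)) * h3 / π

theorem hankelFn_neg (ν x : ℝ) :
    hankelFn (-ν) x = Complex.exp (ν * π * Complex.I) * hankelFn ν x := by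
  unfold hankelFn
  rw [schlafliOsc_neg, neg_neg]
  have h : Complex.exp (ν * π * Complex.I) * Complex.exp (-(ν * π * Complex.I)) = 1 := by
    rw [← Complex.exp_add, add_neg_cancel, Complex.exp_zero]
  push_cast
  rw [neg_mul, neg_mul, neg_neg]
  linear_combination (Complex.I * schlafliExp (-ν) x / π) * h

theorem continuous_hankelFn {x : ℝ} (hx : 0 < x) : Continuous fun ν => hankelFn ν x := by
  unfold hankelFn
  have h1 := continuous_schlafliOsc x
  have h2 := continuous_schlafliExp hx
  have h3 : Continuous fun ν => schlafliExp (-ν) x := h2.comp continuous_neg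
  fun_prop

/-- Real part of the Hankel function. -/
noncomputable def hankelRe (ν x : ℝ) : ℝ := (hankelFn ν x).re

/-- Imaginary part of the Hankel function. -/
noncomputable def hankelIm (ν x : ℝ) : ℝ := (hankelFn ν x).im

theorem hankelFn_eq (ν x : ℝ) :
    hankelFn ν x = hankelRe ν x + hankelIm ν x * Complex.I :=
  (Complex.re_add_im _).symm

theorem hankelFn_sub_one (ν : ℝ) {x : ℝ} (hx : 0 < x) :
    hankelFn (ν - 1) x = (2 * ν / x : ℝ) * hankelFn ν x - hankelFn (ν + 1) x := by
  have h := hankelFn_recurrence ν hx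
  have hx' : (x : ℂ) ≠ 0 := by exact_mod_cast hx.ne'
  have : hankelFn (ν - 1) x + hankelFn (ν + 1) x = (2 * ν / x : ℝ) * hankelFn ν x := by
    push_cast
    field_simp
    linear_combination 2 * h
  linear_combination this

theorem hasDerivAt_hankelFn' (ν : ℝ) {x : ℝ} (hx : 0 < x) :
    HasDerivAt (hankelFn ν) ((ν / x : ℝ) * hankelFn ν x - hankelFn (ν + 1) x) x := by
  refine (hasDerivAt_hankelFn ν hx).congr_deriv ?_
  rw [hankelFn_sub_one ν hx]
  push_cast
  ring

theorem isCylinderFamily_hankelRe : IsCylinderFamily hankelRe where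
  hasDerivAt ν x hx := by
    have h := Complex.reCLM.hasFDerivAt.comp_hasDerivAt x (hasDerivAt_hankelFn' ν hx)
    refine h.congr_deriv ?_
    simp only [Complex.reCLM_apply, Complex.sub_re, Complex.re_ofReal_mul]
    rfl
  sub_one ν x hx := by
    have h := congrArg Complex.re (hankelFn_sub_one ν hx)
    rwa [Complex.sub_re, Complex.re_ofReal_mul] at h

theorem isCylinderFamily_hankelIm : IsCylinderFamily hankelIm where
  hasDerivAt ν x hx := by
    have h := Complex.imCLM.hasFDerivAt.comp_hasDerivAt x (hasDerivAt_hankelFn' ν hx)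
    refine h.congr_deriv ?_
    simp only [Complex.imCLM_apply, Complex.sub_im, Complex.im_ofReal_mul]
    rfl
  sub_one ν x hx := by
    have h := congrArg Complex.im (hankelFn_sub_one ν hx)
    rwa [Complex.sub_im, Complex.im_ofReal_mul] at h

theorem cexp_mul_I_mul_re (t : ℝ) (z : ℂ) :
    (Complex.exp (t * Complex.I) * z).re = Real.cos t * z.re - Real.sin t * z.im := by
  rw [Complex.mul_re, Complex.exp_ofReal_mul_I_re, Complex.exp_ofReal_mul_I_im]

theorem hankelRe_neg (ν x : ℝ) :
    hankelRe (-ν) x = Real.cos (ν * π) * hankelRe ν x - Real.sin (ν * π) * hankelIm ν x := by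
  have h := congrArg Complex.re (hankelFn_neg ν x)
  rw [← Complex.ofReal_mul, cexp_mul_I_mul_re] at h
  exact h

theorem hankelRe_eq (ν x : ℝ) :
    hankelRe ν x = ((schlafliOsc ν x).re - Real.sin (ν * π) * schlafliExp (-ν) x) / π := by
  have e : Complex.exp (-(ν * π * Complex.I)) = Complex.exp ((-(ν * π) : ℝ) * Complex.I) := by
    push_cast
    ring_nf
  unfold hankelRe hankelFn
  rw [Complex.div_ofReal_re, Complex.sub_re, Complex.I_mul_re, Complex.add_im, Complex.ofReal_im,
    Complex.im_mul_ofReal, e, Complex.exp_ofReal_mul_I_im, Real.sin_neg]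
  ring

theorem norm_schlafliOsc_le (ν x : ℝ) : ‖schlafliOsc ν x‖ ≤ π := by
  have h := intervalIntegral.norm_integral_le_of_norm_le_const (a := 0) (b := π) (C := 1)
    (f := fun θ => Complex.exp (Complex.I * (x * Real.sin θ - ν * θ : ℝ)))
    fun θ _ => (Complex.norm_exp_I_mul_ofReal _).le
  rw [one_mul, sub_zero, abs_of_pos Real.pi_pos] at h
  exact h

theorem abs_hankelRe_le {ν x : ℝ} (hν : 0 < ν) (hx : 0 < x) :
    |hankelRe ν x| ≤ (π + 1 / ν) / π := by
  rw [hankelRe_eq, abs_div, abs_of_pos Real.pi_pos]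
  gcongr
  refine (abs_sub _ _).trans (add_le_add ((Complex.abs_re_le_norm _).trans
    (norm_schlafliOsc_le ν x)) ?_)
  rw [abs_mul, abs_of_nonneg (schlafliExp_nonneg _ _)]
  have h1 := schlafliExp_le (-ν) hx (by linarith)
  have h2 : 1 / (x - -ν) ≤ 1 / ν := by
    apply one_div_le_one_div_of_le hν
    linarith
  calc _ ≤ 1 * schlafliExp (-ν) x :=
        mul_le_mul_of_nonneg_right (Real.abs_sin_le_one _) (schlafliExp_nonneg _ _)
    _ ≤ _ := by linarith

theorem tendsto_besselEntire_sq (ν : ℝ) :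
    Tendsto (fun x : ℝ => besselEntire ν ((x / 2) ^ 2)) (nhdsWithin 0 (Set.Ioi 0))
      (nhds (Real.Gamma (ν + 1))⁻¹) := by
  have h : Continuous fun x : ℝ => besselEntire ν ((x / 2) ^ 2) :=
    (continuous_besselEntire ν).comp (by fun_prop)
  have h0 := h.tendsto 0
  simp only [zero_div, ne_eq, OfNat.ofNat_ne_zero, not_false_eq_true, zero_pow,
    besselEntire_zero] at h0
  exact h0.mono_left nhdsWithin_le_nhds

theorem tendsto_besselJ_zero {ν : ℝ} (hν : 0 < ν) :
    Tendsto (besselJ ν) (nhdsWithin 0 (Set.Ioi 0)) (nhds 0) := by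
  have h1 : Tendsto (fun x : ℝ => (x / 2) ^ ν) (nhdsWithin 0 (Set.Ioi 0)) (nhds 0) := by
    have h : ContinuousAt (fun x : ℝ => (x / 2) ^ ν) 0 :=
      ContinuousAt.rpow_const (by fun_prop) (Or.inr hν.le)
    have h0 := h.tendsto
    simp only [zero_div, Real.zero_rpow hν.ne'] at h0
    exact h0.mono_left nhdsWithin_le_nhds
  have h := h1.mul (tendsto_besselEntire_sq ν)
  rw [zero_mul] at h
  refine h.congr' ?_
  filter_upwards [self_mem_nhdsWithin] with x hx
  exact (besselJ_eq ν hx).symm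

theorem eventually_besselEntire_sq_pos {ν : ℝ} (hν : -1 < ν) :
    ∀ᶠ x in nhdsWithin (0 : ℝ) (Set.Ioi 0), 0 < besselEntire ν ((x / 2) ^ 2) :=
  (tendsto_besselEntire_sq ν).eventually_const_lt
    (inv_pos.2 (Real.Gamma_pos_of_pos (by linarith)))

theorem eventually_besselJ_pos {ν : ℝ} (hν : -1 < ν) :
    ∀ᶠ x in nhdsWithin (0 : ℝ) (Set.Ioi 0), 0 < besselJ ν x := by
  filter_upwards [eventually_besselEntire_sq_pos hν, self_mem_nhdsWithin] with x h hx
  have hx' : 0 < x := hx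
  rw [besselJ_eq ν hx']
  positivity

theorem besselJ_hankelRe_wronskian {ν : ℝ} (hν : 0 < ν) {x : ℝ} (hx : 0 < x) :
    besselJ ν x * hankelRe (ν + 1) x = besselJ (ν + 1) x * hankelRe ν x := by
  have hW := fun y (hy : 0 < y) => (isCylinderFamily_besselJ.isBesselSol ν).hasDerivAt_wronskian
    (isCylinderFamily_hankelRe.isBesselSol ν) (x := y) hy
  have hlim : Tendsto (fun x => besselJ ν x * (ν * hankelRe ν x - x * hankelRe (ν + 1) x) -
      (ν * besselJ ν x - x * besselJ (ν + 1) x) * hankelRe ν x)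
      (nhdsWithin 0 (Set.Ioi 0)) (nhds 0) := by
    have hx0 : Tendsto (fun x : ℝ => x) (nhdsWithin 0 (Set.Ioi 0)) (nhds 0) :=
      tendsto_id.mono_left nhdsWithin_le_nhds
    have hb : ∀ {μ : ℝ}, 0 < μ → IsBoundedUnder (· ≤ ·) (nhdsWithin 0 (Set.Ioi 0))
        (norm ∘ hankelRe μ) := fun {μ} hμ =>
      isBoundedUnder_of_eventually_le (a := (π + 1 / μ) / π) (by
        filter_upwards [self_mem_nhdsWithin] with y hy
        exact abs_hankelRe_le hμ hy)
    have h1 := Filter.Tendsto.zero_mul_isBoundedUnder_le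
      (by simpa using hx0.mul (tendsto_besselJ_zero hν)) (hb (by linarith : 0 < ν + 1))
    have h2 := Filter.Tendsto.zero_mul_isBoundedUnder_le
      (by simpa using hx0.mul (tendsto_besselJ_zero (by linarith : 0 < ν + 1))) (hb hν)
    have h3 := h2.sub h1
    rw [sub_zero] at h3
    refine h3.congr fun y => ?_
    ring
  have hc : ∀ y : ℝ, 0 < y → besselJ ν y * (ν * hankelRe ν y - y * hankelRe (ν + 1) y) -
      (ν * besselJ ν y - y * besselJ (ν + 1) y) * hankelRe ν y =
      besselJ ν x * (ν * hankelRe ν x - x * hankelRe (ν + 1) x) -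
      (ν * besselJ ν x - x * besselJ (ν + 1) x) * hankelRe ν x := fun y hy =>
    eq_of_hasDerivAt_zero hW hy hx
  have h2 := tendsto_nhds_unique hlim ((tendsto_const_nhds).congr' (by
    filter_upwards [self_mem_nhdsWithin] with y hy
    exact (hc y hy).symm))
  have h3 : x * (besselJ ν x * hankelRe (ν + 1) x - besselJ (ν + 1) x * hankelRe ν x) = 0 := by
    linarith
  have := (mul_eq_zero.1 h3).resolve_left hx.ne'
  linarith

theorem exists_hankelRe_eq_mul_besselJ {ν : ℝ} (hν : 0 < ν) :
    ∃ c : ℝ, ∀ x, 0 < x → hankelRe ν x = c * besselJ ν x := by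
  obtain ⟨a, hJ, ha⟩ := ((eventually_besselJ_pos (by linarith : -1 < ν)).and
    self_mem_nhdsWithin).exists
  have ha' : 0 < a := ha
  refine ⟨hankelRe ν a / besselJ ν a, fun x hx => ?_⟩
  have h := ((isCylinderFamily_hankelRe.isBesselSol ν).comb
    (isCylinderFamily_besselJ.isBesselSol ν) 1 (-(hankelRe ν a / besselJ ν a))).eq_zero_of_initial
    ha' (by field_simp; ring) (by
      have := besselJ_hankelRe_wronskian hν ha'
      field_simp
      linear_combination (-a) * this) hx
  linarith

theorem IsCylinderFamily.eq_mul_of_eq_mul {F G : ℝ → ℝ → ℝ} (hF : IsCylinderFamily F)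
    (hG : IsCylinderFamily G) {ν c : ℝ} (h : ∀ x, 0 < x → F ν x = c * G ν x) :
    (∀ x, 0 < x → F (ν + 1) x = c * G (ν + 1) x) ∧
      ∀ x, 0 < x → F (ν - 1) x = c * G (ν - 1) x := by
  have h1 : ∀ x, 0 < x → F (ν + 1) x = c * G (ν + 1) x := fun x hx => by
    have hd := ((hG.hasDerivAt ν x hx).const_mul c).congr_of_eventuallyEq (f₁ := F ν) (by
      filter_upwards [eventually_gt_nhds hx] with y hy
      exact h y hy)
    have := hd.unique (hF.hasDerivAt ν x hx)
    rw [h x hx] at this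
    linear_combination this
  refine ⟨h1, fun x hx => ?_⟩
  rw [hF.sub_one ν x hx, hG.sub_one ν x hx, h x hx, h1 x hx]
  ring

theorem tendsto_rpow_mul_schlafliExp {a : ℝ} (ha : 0 < a) :
    Tendsto (fun x => (x / 2) ^ a * schlafliExp a x) (nhdsWithin 0 (Set.Ioi 0))
      (nhds (Real.Gamma a)) := by
  have hG := Real.GammaIntegral_convergent ha
  have hg : ∀ ε : ℝ, 0 < ε → MeasureTheory.IntegrableOn
      (fun u : ℝ => Real.exp (-u) * u ^ (a - 1)) (Set.Ioi ε) := fun ε hε =>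
    hG.mono_set (Set.Ioi_subset_Ioi hε.le)
  have hlow : ∀ ε : ℝ, 0 < ε → Real.Gamma a - ε ^ a / a ≤
      ∫ u in Set.Ioi ε, Real.exp (-u) * u ^ (a - 1) := fun ε hε => by
    have hI : MeasureTheory.IntegrableOn (fun u : ℝ => Real.exp (-u) * u ^ (a - 1))
        (Set.Ioc 0 ε) := hG.mono_set Set.Ioc_subset_Ioi_self
    have hs := MeasureTheory.setIntegral_union (Set.Ioc_disjoint_Ioi le_rfl)
      measurableSet_Ioi hI (hg ε hε)
    rw [Set.Ioc_union_Ioi_eq_Ioi hε.le, ← Real.Gamma_eq_integral ha] at hs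
    have hp := intervalIntegral.intervalIntegrable_rpow' (a := 0) (b := ε)
      (by linarith : -1 < a - 1)
    have hr := integral_rpow (a := 0) (b := ε) (r := a - 1) (Or.inl (by linarith))
    rw [sub_add_cancel, Real.zero_rpow ha.ne', sub_zero,
      intervalIntegral.integral_of_le hε.le] at hr
    rw [intervalIntegrable_iff_integrableOn_Ioc_of_le hε.le] at hp
    have := MeasureTheory.setIntegral_mono_on hI hp measurableSet_Ioc fun u hu => by
      have h1 : Real.exp (-u) ≤ 1 := Real.exp_le_one_iff.2 (by linarith [hu.1])
      exact mul_le_of_le_one_left (Real.rpow_nonneg hu.1.le _) h1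
    linarith
  have hup : ∀ ε : ℝ, 0 < ε → ∫ u in Set.Ioi ε, Real.exp (-u) * u ^ (a - 1) ≤
      Real.Gamma a := fun ε hε => by
    rw [Real.Gamma_eq_integral ha]
    refine MeasureTheory.setIntegral_mono_set hG ?_ (Set.Ioi_subset_Ioi hε.le).eventuallyLE
    refine (MeasureTheory.ae_restrict_mem measurableSet_Ioi).mono fun u hu => ?_
    have hu' : (0 : ℝ) < u := hu
    simp only [Pi.zero_apply]
    positivity
  have hL : ∀ x : ℝ, 0 < x → MeasureTheory.IntegrableOn
      (fun t : ℝ => Real.exp (a * t - x / 2 * Real.exp t)) (Set.Ioi 0) := fun x hx => by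
    refine (integrableOn_schlafliExp a hx).mono' (by fun_prop : Continuous _).aestronglyMeasurable
      (MeasureTheory.ae_of_all _ fun t => ?_)
    rw [Real.norm_eq_abs, Real.abs_exp, Real.sinh_eq]
    refine Real.exp_le_exp.2 ?_
    nlinarith [Real.exp_pos (-t)]
  have hsub : ∀ x : ℝ, 0 < x → (x / 2) ^ a * (∫ t in Set.Ioi (0 : ℝ),
      Real.exp (a * t - x / 2 * Real.exp t)) =
      ∫ u in Set.Ioi (x / 2), Real.exp (-u) * u ^ (a - 1) := fun x hx => by
    have hx2 : 0 < x / 2 := by positivity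
    have hpos : ∀ t, 0 < x / 2 * Real.exp t := fun t => by positivity
    have e : ∀ t, Real.exp (-(x / 2 * Real.exp t)) * (x / 2 * Real.exp t) ^ (a - 1) *
        (x / 2 * Real.exp t) = (x / 2) ^ a * Real.exp (a * t - x / 2 * Real.exp t) := fun t => by
      rw [mul_assoc, ← Real.rpow_add_one (hpos t).ne', sub_add_cancel,
        Real.mul_rpow hx2.le (Real.exp_pos t).le, ← Real.exp_mul, mul_comm t a,
        sub_eq_add_neg, Real.exp_add]
      ring
    have h := MeasureTheory.integral_comp_mul_deriv_Ioi (a := 0)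
      (f := fun t => x / 2 * Real.exp t) (f' := fun t => x / 2 * Real.exp t)
      (g := fun u : ℝ => Real.exp (-u) * u ^ (a - 1)) (by fun_prop)
      (Real.tendsto_exp_atTop.const_mul_atTop hx2)
      (fun t _ => ((Real.hasDerivAt_exp t).const_mul (x / 2)).hasDerivWithinAt) ?_ ?_ ?_
    · rw [Real.exp_zero, mul_one] at h
      rw [← h, ← MeasureTheory.integral_const_mul]
      exact MeasureTheory.integral_congr_ae (MeasureTheory.ae_of_all _ fun t => (e t).symm)
    · rintro _ ⟨t, -, rfl⟩
      exact ((by fun_prop : Continuous fun u : ℝ => Real.exp (-u)).continuousAt.mul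
        (continuousAt_id.rpow_const (Or.inl (hpos t).ne'))).continuousWithinAt
    · refine hG.mono_set ?_
      rintro _ ⟨t, -, rfl⟩
      exact hpos t
    · rw [integrableOn_Ici_iff_integrableOn_Ioi]
      exact ((hL x hx).const_mul ((x / 2) ^ a)).congr
        (MeasureTheory.ae_of_all _ fun t => (e t).symm)
  have hK1 : ∀ x : ℝ, 0 < x → (∫ t in Set.Ioi (0 : ℝ),
      Real.exp (a * t - x / 2 * Real.exp t)) ≤ schlafliExp a x := fun x hx => by
    refine MeasureTheory.setIntegral_mono (hL x hx) (integrableOn_schlafliExp a hx) fun t => ?_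
    simp only [Real.sinh_eq]
    refine Real.exp_le_exp.2 ?_
    nlinarith [Real.exp_pos (-t)]
  have hK2 : ∀ x : ℝ, 0 < x → schlafliExp a x ≤ Real.exp (x / 2) * (∫ t in Set.Ioi (0 : ℝ),
      Real.exp (a * t - x / 2 * Real.exp t)) := fun x hx => by
    rw [← MeasureTheory.integral_const_mul]
    refine MeasureTheory.setIntegral_mono_on (integrableOn_schlafliExp a hx)
      ((hL x hx).const_mul _) measurableSet_Ioi fun t ht => ?_
    rw [Real.sinh_eq, ← Real.exp_add]
    have h1 : Real.exp (-t) ≤ 1 := Real.exp_le_one_iff.2 (by linarith [Set.mem_Ioi.1 ht])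
    refine Real.exp_le_exp.2 ?_
    nlinarith
  have hx0 : Tendsto (fun x : ℝ => x) (nhdsWithin 0 (Set.Ioi 0)) (nhds 0) :=
    tendsto_id.mono_left nhdsWithin_le_nhds
  refine tendsto_of_tendsto_of_tendsto_of_le_of_le'
    (g := fun x : ℝ => Real.Gamma a - (x / 2) ^ a / a)
    (h := fun x : ℝ => Real.exp (x / 2) * Real.Gamma a) ?_ ?_ ?_ ?_
  · have h : ContinuousAt (fun x : ℝ => Real.Gamma a - (x / 2) ^ a / a) 0 :=
      continuousAt_const.sub ((ContinuousAt.rpow_const (by fun_prop) (Or.inr ha.le)).div_const a)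
    have h0 := h.tendsto
    simp only [zero_div, Real.zero_rpow ha.ne', sub_zero] at h0
    exact h0.mono_left nhdsWithin_le_nhds
  · have h : Continuous (fun x : ℝ => Real.exp (x / 2) * Real.Gamma a) := by fun_prop
    have h0 := h.tendsto 0
    simp only [zero_div, Real.exp_zero, one_mul] at h0
    exact h0.mono_left nhdsWithin_le_nhds
  · filter_upwards [self_mem_nhdsWithin] with x hx
    have hx' : 0 < x := hx
    refine (hlow (x / 2) (by positivity)).trans ?_
    rw [← hsub x hx']
    exact mul_le_mul_of_nonneg_left (hK1 x hx') (by positivity)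
  · filter_upwards [self_mem_nhdsWithin] with x hx
    have hx' : 0 < x := hx
    refine (mul_le_mul_of_nonneg_left (hK2 x hx') (by positivity)).trans ?_
    rw [mul_left_comm, hsub x hx']
    exact mul_le_mul_of_nonneg_left (hup (x / 2) (by positivity)) (Real.exp_pos _).le

theorem tendsto_hankelRe_zero_zero :
    Tendsto (hankelRe 0) (nhdsWithin 0 (Set.Ioi 0)) (nhds 1) := by
  have h := (Complex.continuous_re.continuousAt.comp (hasDerivAt_schlafliOsc 0 0).continuousAt).tendsto
  have h0 : schlafliOsc 0 0 = π := by simp [schlafliOsc]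
  have h1 := (h.mono_left (nhdsWithin_le_nhds (s := Set.Ioi 0))).div_const π
  simp only [Function.comp, h0, Complex.ofReal_re, div_self Real.pi_ne_zero] at h1
  refine h1.congr fun x => ?_
  rw [hankelRe_eq]
  simp

theorem tendsto_hankelRe_neg {a : ℝ} (ha : 0 < a) :
    Tendsto (fun x => (x / 2) ^ a * hankelRe (-a) x) (nhdsWithin 0 (Set.Ioi 0))
      (nhds (Real.sin (a * π) * Real.Gamma a / π)) := by
  have h1 := ((tendsto_rpow_mul_schlafliExp ha).const_mul (Real.sin (a * π))).div_const π
  have h2 : Tendsto (fun x : ℝ => (x / 2) ^ a) (nhdsWithin 0 (Set.Ioi 0)) (nhds 0) := by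
    have h : ContinuousAt (fun x : ℝ => (x / 2) ^ a) 0 :=
      ContinuousAt.rpow_const (by fun_prop) (Or.inr ha.le)
    have h0 := h.tendsto
    simp only [zero_div, Real.zero_rpow ha.ne'] at h0
    exact h0.mono_left nhdsWithin_le_nhds
  have h3 := (h2.zero_mul_isBoundedUnder_le (g := fun x => (schlafliOsc (-a) x).re)
    (isBoundedUnder_of_eventually_le (a := π) (Filter.Eventually.of_forall fun x =>
      (Complex.abs_re_le_norm _).trans (norm_schlafliOsc_le _ _)))).div_const π
  have h4 := h3.add h1
  rw [zero_div, zero_add] at h4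
  refine h4.congr fun x => ?_
  rw [hankelRe_eq, neg_neg, neg_mul, Real.sin_neg]
  ring

theorem tendsto_besselJ_neg {a : ℝ} :
    Tendsto (fun x => (x / 2) ^ a * besselJ (-a) x) (nhdsWithin 0 (Set.Ioi 0))
      (nhds (Real.Gamma (1 - a))⁻¹) := by
  have h := tendsto_besselEntire_sq (-a)
  rw [neg_add_eq_sub] at h
  refine h.congr' ?_
  filter_upwards [self_mem_nhdsWithin] with x hx
  have hx' : 0 < x := hx
  rw [besselJ_eq _ hx', ← mul_assoc, ← Real.rpow_add (by positivity), add_neg_cancel,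
    Real.rpow_zero, one_mul]

theorem hankelRe_eq_besselJ_of_mem {ν : ℝ} (hν : 0 < ν) (hν1 : ν ≤ 1) {x : ℝ} (hx : 0 < x) :
    hankelRe ν x = besselJ ν x := by
  obtain ⟨c, hc⟩ := exists_hankelRe_eq_mul_besselJ hν
  have hm := (isCylinderFamily_hankelRe.eq_mul_of_eq_mul isCylinderFamily_besselJ hc).2
  have hJ := tendsto_besselJ_neg (a := 1 - ν)
  rw [neg_sub, sub_sub_cancel] at hJ
  have hG : Real.Gamma ν ≠ 0 := (Real.Gamma_pos_of_pos hν).ne'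
  suffices c = 1 by rw [hc x hx, this, one_mul]
  have key : ∀ L : ℝ, Tendsto (fun x => (x / 2) ^ (1 - ν) * hankelRe (ν - 1) x)
      (nhdsWithin 0 (Set.Ioi 0)) (nhds L) → L = c * (Real.Gamma ν)⁻¹ := fun L hL => by
    refine tendsto_nhds_unique hL ((hJ.const_mul c).congr' ?_)
    filter_upwards [self_mem_nhdsWithin] with y hy
    rw [hm y hy]
    ring
  rcases hν1.eq_or_lt with rfl | hlt
  · have := key 1 (by simpa using tendsto_hankelRe_zero_zero)
    simpa using this.symm
  · have h1 := tendsto_hankelRe_neg (a := 1 - ν) (by linarith)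
    rw [neg_sub] at h1
    have h2 := key _ h1
    have h3 := Real.Gamma_mul_Gamma_one_sub (1 - ν)
    rw [sub_sub_cancel] at h3
    have hs : 0 < Real.sin (π * (1 - ν)) := by
      apply Real.sin_pos_of_pos_of_lt_pi
      · have := Real.pi_pos
        nlinarith
      · nlinarith [Real.pi_pos]
    rw [mul_comm (1 - ν)] at h2
    field_simp at h2 h3
    have hpi := Real.pi_ne_zero
    have : π * (c - 1) = 0 := by linarith
    have := (mul_eq_zero.1 this).resolve_left hpi
    linarith

theorem hankelRe_eq_besselJ (ν : ℝ) {x : ℝ} (hx : 0 < x) : hankelRe ν x = besselJ ν x := by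
  have step : ∀ μ : ℝ, (∀ x, 0 < x → hankelRe μ x = besselJ μ x) →
      (∀ x, 0 < x → hankelRe (μ + 1) x = besselJ (μ + 1) x) ∧
        ∀ x, 0 < x → hankelRe (μ - 1) x = besselJ (μ - 1) x := fun μ h => by
    have := isCylinderFamily_hankelRe.eq_mul_of_eq_mul isCylinderFamily_besselJ (c := 1)
      (fun x hx => by rw [h x hx, one_mul])
    simpa using this
  have hall : ∀ n : ℤ, ∀ x, 0 < x →
      hankelRe (ν - (⌈ν⌉ - 1) + n) x = besselJ (ν - (⌈ν⌉ - 1) + n) x := by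
    intro n
    induction n using Int.induction_on with
    | zero =>
      intro x hx
      rw [Int.cast_zero, add_zero]
      refine hankelRe_eq_besselJ_of_mem ?_ ?_ hx
      · linarith [Int.ceil_lt_add_one ν]
      · linarith [Int.le_ceil ν]
    | succ i ih =>
      have := (step _ ih).1
      push_cast
      rwa [add_assoc] at this
    | pred i ih =>
      have := (step _ ih).2
      push_cast at this ⊢
      rwa [add_sub_assoc] at this
  have h := hall (⌈ν⌉ - 1) x hx
  push_cast at h
  rwa [sub_add_cancel] at h

theorem hankelIm_eq_besselY (ν : ℝ) {x : ℝ} (hx : 0 < x) : hankelIm ν x = besselY ν x := by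
  have hne : (nhdsWithin ν {μ : ℝ | ∀ n : ℤ, μ ≠ (n : ℝ)}).NeBot := by
    rw [← mem_closure_iff_nhdsWithin_neBot]
    have hd := (Set.countable_range ((↑) : ℤ → ℝ)).dense_compl ℝ
    have he : {μ : ℝ | ∀ n : ℤ, μ ≠ (n : ℝ)} = (Set.range ((↑) : ℤ → ℝ))ᶜ := by
      ext μ
      simp [eq_comm]
    rw [he]
    exact hd ν
  have hcont : Continuous fun μ => hankelIm μ x :=
    Complex.continuous_im.comp (continuous_hankelFn hx)
  refine (Tendsto.limUnder_eq (((hcont.tendsto ν).mono_left nhdsWithin_le_nhds).congr' ?_)).symm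
  filter_upwards [self_mem_nhdsWithin] with μ hμ
  have hs : Real.sin (μ * π) ≠ 0 := fun h0 => by
    obtain ⟨n, hn⟩ := Real.sin_eq_zero_iff.1 h0
    exact hμ n (mul_right_cancel₀ Real.pi_ne_zero hn).symm
  rw [← hankelRe_eq_besselJ _ hx, ← hankelRe_eq_besselJ _ hx, hankelRe_neg]
  field_simp
  ring

theorem cexp_mul_schlafliOsc (ν x : ℝ) :
    Complex.exp ((ν * (π / 2) : ℝ) * Complex.I) * schlafliOsc ν x =
      ∫ s in (-(π / 2))..(π / 2), Complex.exp (Complex.I * (x * Real.cos s : ℝ)) *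
        Complex.exp (-(ν * s * Complex.I)) := by
  have h := intervalIntegral.integral_comp_add_right (a := -(π / 2)) (b := π / 2)
    (fun θ => Complex.exp (Complex.I * (x * Real.sin θ - ν * θ : ℝ))) (π / 2)
  rw [neg_add_cancel, add_halves] at h
  rw [schlafliOsc, ← h, ← intervalIntegral.integral_const_mul]
  refine intervalIntegral.integral_congr fun s _ => ?_
  simp only [Real.sin_add_pi_div_two]
  rw [← Complex.exp_add, ← Complex.exp_add]
  congr 1
  push_cast
  ring

theorem exists_norm_integral_exp_cos_mul_sin_le {h h' : ℝ → ℂ}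
    (hd : ∀ s ∈ Set.uIcc (-(π / 2)) (π / 2), HasDerivAt h (h' s) s)
    (hc : ContinuousOn h' (Set.uIcc (-(π / 2)) (π / 2))) :
    ∃ C : ℝ, ∀ x : ℝ, 0 < x →
      ‖∫ s in (-(π / 2))..(π / 2), Complex.exp (Complex.I * (x * Real.cos s : ℝ)) *
        (Real.sin s * h s)‖ ≤ C / x := by
  obtain ⟨M, hM⟩ := isCompact_uIcc.exists_bound_of_continuousOn hc
  refine ⟨‖h (π / 2)‖ + ‖h (-(π / 2))‖ + M * |π / 2 - -(π / 2)|, fun x hx => ?_⟩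
  have hV : ∀ s ∈ Set.uIcc (-(π / 2)) (π / 2), HasDerivAt
      (fun s : ℝ => Complex.exp (Complex.I * (x * Real.cos s : ℝ)))
      (Complex.I * (x * -Real.sin s : ℝ) * Complex.exp (Complex.I * (x * Real.cos s : ℝ))) s :=
    fun s _ => hasDerivAt_cexp_I_mul ((Real.hasDerivAt_cos s).const_mul x)
  have key := intervalIntegral.integral_mul_deriv_eq_deriv_mul hd hV hc.intervalIntegrable
    ((by fun_prop : Continuous fun s : ℝ => Complex.I * (x * -Real.sin s : ℝ) *
      Complex.exp (Complex.I * (x * Real.cos s : ℝ))).intervalIntegrable _ _)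
  have e : (∫ s in (-(π / 2))..(π / 2), h s * (Complex.I * (x * -Real.sin s : ℝ) *
      Complex.exp (Complex.I * (x * Real.cos s : ℝ)))) =
      (-Complex.I * x) * ∫ s in (-(π / 2))..(π / 2),
        Complex.exp (Complex.I * (x * Real.cos s : ℝ)) * (Real.sin s * h s) := by
    rw [← intervalIntegral.integral_const_mul]
    refine intervalIntegral.integral_congr fun s _ => ?_
    push_cast
    ring
  rw [e] at key
  have hn := congrArg norm key
  rw [norm_mul, norm_mul, norm_neg, Complex.norm_I, one_mul, Complex.norm_real,
    Real.norm_of_nonneg hx.le] at hn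
  rw [le_div_iff₀ hx, mul_comm, hn]
  refine (norm_sub_le _ _).trans (add_le_add ((norm_sub_le _ _).trans ?_) ?_)
  · rw [norm_mul, norm_mul, Complex.norm_exp_I_mul_ofReal, Complex.norm_exp_I_mul_ofReal, mul_one,
      mul_one]
  · refine intervalIntegral.norm_integral_le_of_norm_le_const fun s hs => ?_
    rw [norm_mul, Complex.norm_exp_I_mul_ofReal, mul_one]
    exact hM s (Set.uIoc_subset_uIcc hs)

theorem dslope_sin_ne_zero {s : ℝ} (hs : s ∈ Set.uIcc (-(π / 2)) (π / 2)) :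
    dslope Complex.sin 0 (s : ℂ) ≠ 0 := by
  rw [Set.uIcc_of_le (by linarith [Real.pi_pos])] at hs
  by_cases h0 : s = 0
  · rw [h0, Complex.ofReal_zero, dslope_same, Complex.deriv_sin, Complex.cos_zero]
    exact one_ne_zero
  · rw [dslope_of_ne _ (by exact_mod_cast h0), slope_def_field, Complex.sin_zero, sub_zero,
      sub_zero, ← Complex.ofReal_sin, ← Complex.ofReal_div]
    have : Real.sin s ≠ 0 := by
      rw [Ne, Real.sin_eq_zero_iff_of_lt_of_lt (by linarith [Real.pi_pos, hs.1])
        (by linarith [Real.pi_pos, hs.2])]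
      exact h0
    exact_mod_cast div_ne_zero this h0

theorem exists_norm_schlafliOsc_sub_le (ν μ : ℝ) :
    ∃ C : ℝ, ∀ x : ℝ, 0 < x →
      ‖Complex.exp ((ν * (π / 2) : ℝ) * Complex.I) * schlafliOsc ν x -
        Complex.exp ((μ * (π / 2) : ℝ) * Complex.I) * schlafliOsc μ x‖ ≤ C / x := by
  set g : ℂ → ℂ := fun z => Complex.exp (-(ν * z * Complex.I)) - Complex.exp (-(μ * z * Complex.I))
    with hg
  have hgd : Differentiable ℂ g := by fun_prop
  have hg1 : Differentiable ℂ (dslope g 0) := fun z =>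
    ((Complex.differentiableOn_dslope Filter.univ_mem).2 hgd.differentiableOn).differentiableAt
      Filter.univ_mem
  have hs1 : Differentiable ℂ (dslope Complex.sin 0) := fun z =>
    ((Complex.differentiableOn_dslope Filter.univ_mem).2
      Complex.differentiable_sin.differentiableOn).differentiableAt Filter.univ_mem
  set q : ℂ → ℂ := fun z => dslope g 0 z / dslope Complex.sin 0 z with hq
  set U : Set ℂ := {z | dslope Complex.sin 0 z ≠ 0} with hU
  have hUo : IsOpen U := isOpen_ne_fun hs1.continuous continuous_const
  have hqd : DifferentiableOn ℂ q U := fun z hz =>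
    ((hg1 z).div (hs1 z) hz).differentiableWithinAt
  have hmem : ∀ s ∈ Set.uIcc (-(π / 2)) (π / 2), (s : ℂ) ∈ U := fun s hs => dslope_sin_ne_zero hs
  obtain ⟨C, hC⟩ := exists_norm_integral_exp_cos_mul_sin_le (h := fun s : ℝ => q s)
    (h' := fun s : ℝ => deriv q s)
    (fun s hs => (hqd.differentiableAt (hUo.mem_nhds (hmem s hs))).hasDerivAt.comp_ofReal)
    ((hqd.deriv hUo).continuousOn.comp Complex.continuous_ofReal.continuousOn hmem)
  refine ⟨C, fun x hx => ?_⟩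
  convert hC x hx using 2
  rw [cexp_mul_schlafliOsc, cexp_mul_schlafliOsc, ← intervalIntegral.integral_sub]
  · refine intervalIntegral.integral_congr fun s hs => ?_
    rw [← mul_sub]
    congr 1
    have h1 : Complex.sin s = s * dslope Complex.sin 0 (s : ℂ) := by
      have := sub_smul_dslope Complex.sin 0 (s : ℂ)
      rw [Complex.sin_zero, sub_zero, sub_zero, smul_eq_mul] at this
      exact this.symm
    have h2 : g s = s * dslope g 0 (s : ℂ) := by
      have := sub_smul_dslope g 0 (s : ℂ)
      rw [hg] at this
      simp only [mul_zero, zero_mul, sub_self, sub_zero, smul_eq_mul] at this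
      exact this.symm
    have h3 := dslope_sin_ne_zero hs
    change g s = _
    rw [h2, Complex.ofReal_sin, h1, hq]
    field_simp
  · exact (by fun_prop : Continuous _).intervalIntegrable _ _
  · exact (by fun_prop : Continuous _).intervalIntegrable _ _

theorem norm_hankelFn_sub_le {ν x : ℝ} (hx : |ν| < x) :
    ‖Complex.exp ((ν * (π / 2) : ℝ) * Complex.I) * hankelFn ν x -
      Complex.exp ((ν * (π / 2) : ℝ) * Complex.I) * schlafliOsc ν x / π‖ ≤
        2 / π / (x - |ν|) := by
  have hx0 : 0 < x := (abs_nonneg ν).trans_lt hx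
  have e : Complex.exp ((ν * (π / 2) : ℝ) * Complex.I) * hankelFn ν x -
      Complex.exp ((ν * (π / 2) : ℝ) * Complex.I) * schlafliOsc ν x / π =
      -(Complex.exp ((ν * (π / 2) : ℝ) * Complex.I) * Complex.I * (schlafliExp ν x +
        Complex.exp ((-(ν * π) : ℝ) * Complex.I) * schlafliExp (-ν) x) / π) := by
    rw [hankelFn]
    push_cast
    rw [neg_mul]
    ring
  have h1 : schlafliExp ν x ≤ 1 / (x - |ν|) :=
    (schlafliExp_le ν hx0 ((le_abs_self ν).trans_lt hx)).trans
      (one_div_le_one_div_of_le (by linarith) (by linarith [le_abs_self ν]))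
  have h2 : schlafliExp (-ν) x ≤ 1 / (x - |ν|) :=
    (schlafliExp_le (-ν) hx0 ((neg_le_abs ν).trans_lt hx)).trans
      (one_div_le_one_div_of_le (by linarith) (by linarith [neg_le_abs ν]))
  rw [e, norm_neg, norm_div, norm_mul, norm_mul, Complex.norm_exp_ofReal_mul_I, Complex.norm_I,
    one_mul, one_mul, Complex.norm_real, Real.norm_of_nonneg Real.pi_pos.le, div_right_comm]
  gcongr
  refine (norm_add_le _ _).trans ?_
  rw [norm_mul, Complex.norm_exp_ofReal_mul_I, one_mul, Complex.norm_real, Complex.norm_real,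
    Real.norm_of_nonneg (schlafliExp_nonneg _ _), Real.norm_of_nonneg (schlafliExp_nonneg _ _)]
  calc _ ≤ 1 / (x - |ν|) + 1 / (x - |ν|) := add_le_add h1 h2
    _ = _ := by ring

theorem tendsto_sqrt_mul_div_sub (C c : ℝ) :
    Tendsto (fun x : ℝ => √x * (C / (x - c))) atTop (nhds 0) := by
  have h1 : Tendsto (fun x : ℝ => (√x)⁻¹) atTop (nhds 0) :=
    tendsto_inv_atTop_zero.comp Real.tendsto_sqrt_atTop
  have h2 : Tendsto (fun x : ℝ => C / (1 - c * x⁻¹)) atTop (nhds (C / (1 - c * 0))) :=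
    tendsto_const_nhds.div (tendsto_const_nhds.sub (tendsto_inv_atTop_zero.const_mul c))
      (by norm_num)
  have h3 := h1.mul h2
  rw [zero_mul] at h3
  refine h3.congr' ?_
  filter_upwards [eventually_gt_atTop 0, eventually_gt_atTop c] with x hx hxc
  have hs : √x ^ 2 = x := Real.sq_sqrt hx.le
  have hs0 : √x ≠ 0 := (Real.sqrt_pos.2 hx).ne'
  have h4 : x - c ≠ 0 := by linarith
  have h5 : 1 - c * x⁻¹ = (x - c) / x := by field_simp
  rw [h5]
  field_simp
  linear_combination (-C) * hs

/-- The Hankel function with the leading amplitude and the order-dependent phase removed. -/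
noncomputable def hankelHat (ν x : ℝ) : ℂ :=
  √x * (Complex.exp ((ν * (π / 2) : ℝ) * Complex.I) * hankelFn ν x)

theorem tendsto_hankelHat_sub (ν μ : ℝ) :
    Tendsto (fun x => hankelHat ν x - hankelHat μ x) atTop (nhds 0) := by
  obtain ⟨C, hC⟩ := exists_norm_schlafliOsc_sub_le ν μ
  have h0 := ((tendsto_sqrt_mul_div_sub (2 / π) |ν|).add
    (tendsto_sqrt_mul_div_sub (2 / π) |μ|)).add (tendsto_sqrt_mul_div_sub (C / π) 0)
  rw [add_zero, add_zero] at h0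
  refine squeeze_zero_norm' ?_ h0
  filter_upwards [eventually_gt_atTop |ν|, eventually_gt_atTop |μ|, eventually_gt_atTop 0]
    with x hν hμ hx
  have h1 := norm_hankelFn_sub_le hν
  have h2 := norm_hankelFn_sub_le hμ
  have h3 : ‖(Complex.exp ((ν * (π / 2) : ℝ) * Complex.I) * schlafliOsc ν x -
      Complex.exp ((μ * (π / 2) : ℝ) * Complex.I) * schlafliOsc μ x) / π‖ ≤ C / π / x := by
    rw [norm_div, Complex.norm_real, Real.norm_of_nonneg Real.pi_pos.le, div_right_comm C]
    gcongr
    exact hC x hx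
  rw [sub_zero, ← mul_add, ← mul_add, hankelHat, hankelHat, ← mul_sub, norm_mul,
    Complex.norm_real, Real.norm_of_nonneg (Real.sqrt_nonneg x)]
  gcongr
  have e : Complex.exp ((ν * (π / 2) : ℝ) * Complex.I) * hankelFn ν x -
      Complex.exp ((μ * (π / 2) : ℝ) * Complex.I) * hankelFn μ x =
      ((Complex.exp ((ν * (π / 2) : ℝ) * Complex.I) * hankelFn ν x -
        Complex.exp ((ν * (π / 2) : ℝ) * Complex.I) * schlafliOsc ν x / π) -
      (Complex.exp ((μ * (π / 2) : ℝ) * Complex.I) * hankelFn μ x -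
        Complex.exp ((μ * (π / 2) : ℝ) * Complex.I) * schlafliOsc μ x / π)) +
      (Complex.exp ((ν * (π / 2) : ℝ) * Complex.I) * schlafliOsc ν x -
        Complex.exp ((μ * (π / 2) : ℝ) * Complex.I) * schlafliOsc μ x) / π := by ring
  rw [e]
  exact (norm_add_le _ _).trans (add_le_add ((norm_sub_le _ _).trans (add_le_add h1 h2)) h3)

theorem besselEntire_half {x : ℝ} (hx : 0 < x) :
    besselEntire (1 / 2) ((x / 2) ^ 2) = 2 / √π * (Real.sin x / x) := by
  rw [besselEntire, ← (Real.hasSum_sin x).tsum_eq, ← tsum_div_const, ← tsum_mul_left]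
  refine tsum_congr fun k => ?_
  have h := Real.Gamma_mul_Gamma_add_half (k + 1)
  have e1 : (2 * (k + 1) : ℝ) = ((2 * k + 1 : ℕ) : ℝ) + 1 := by push_cast; ring
  have e2 : (1 / 2 + k + 1 : ℝ) = k + 1 + 1 / 2 := by ring
  have e3 : (1 - (((2 * k + 1 : ℕ) : ℝ) + 1)) = -((2 * k + 1 : ℕ) : ℝ) := by ring
  rw [Real.Gamma_nat_eq_factorial, e1, Real.Gamma_nat_eq_factorial, e3,
    Real.rpow_neg zero_le_two, Real.rpow_natCast] at h
  rw [e2, h, neg_pow]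
  have hs : √π ≠ 0 := (Real.sqrt_pos.2 Real.pi_pos).ne'
  have h1 : ((2 * k + 1).factorial : ℝ) ≠ 0 := by positivity
  have h2 : x ^ (2 * k + 1) = (x ^ 2) ^ k * x := by rw [pow_succ, pow_mul]
  have h3 : (2 : ℝ) ^ (2 * k + 1) = 2 * (2 ^ 2) ^ k := by rw [pow_succ, pow_mul, mul_comm]
  rw [h2, h3, div_pow x 2 2, div_pow (x ^ 2)]
  field_simp

theorem besselEntire_neg_half {x : ℝ} :
    besselEntire (-(1 / 2)) ((x / 2) ^ 2) = 1 / √π * Real.cos x := by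
  rw [besselEntire, ← (Real.hasSum_cos x).tsum_eq, ← tsum_mul_left]
  refine tsum_congr fun k => ?_
  have h := Real.Gamma_mul_Gamma_add_half (k + 1 / 2)
  have e1 : (2 * (k + 1 / 2) : ℝ) = ((2 * k : ℕ) : ℝ) + 1 := by push_cast; ring
  have e2 : (-(1 / 2) + k + 1 : ℝ) = k + 1 / 2 := by ring
  have e3 : (1 - (((2 * k : ℕ) : ℝ) + 1)) = -((2 * k : ℕ) : ℝ) := by ring
  rw [add_assoc, add_halves, Real.Gamma_nat_eq_factorial, e1, Real.Gamma_nat_eq_factorial, e3,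
    Real.rpow_neg zero_le_two, Real.rpow_natCast, mul_comm] at h
  rw [e2, h, neg_pow]
  have hs : √π ≠ 0 := (Real.sqrt_pos.2 Real.pi_pos).ne'
  have h1 : ((2 * k).factorial : ℝ) ≠ 0 := by positivity
  rw [pow_mul x, pow_mul 2, div_pow x 2 2, div_pow (x ^ 2)]
  field_simp

/-- The limiting amplitude of `hankelHat ν x * exp (-i x)`. -/
noncomputable def hankelAmp : ℂ := √(2 / π) * Complex.exp (-(π / 4) * Complex.I)

theorem hankelHat_half {x : ℝ} (hx : 0 < x) :
    hankelHat (1 / 2) x = hankelAmp * Complex.exp (x * Complex.I) := by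
  have hsx : √x ^ 2 = x := Real.sq_sqrt hx.le
  have hsx0 : √x ≠ 0 := (Real.sqrt_pos.2 hx).ne'
  have hs : √π ≠ 0 := (Real.sqrt_pos.2 Real.pi_pos).ne'
  have h2 : √(2 : ℝ) ^ 2 = 2 := Real.sq_sqrt zero_le_two
  have h20 : √(2 : ℝ) ≠ 0 := (Real.sqrt_pos.2 zero_lt_two).ne'
  have hJ : √x * hankelRe (1 / 2) x = √(2 / π) * Real.sin x := by
    rw [hankelRe_eq_besselJ _ hx, besselJ_eq _ hx, besselEntire_half hx, ← Real.sqrt_eq_rpow,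
      Real.sqrt_div' _ zero_le_two, Real.sqrt_div' _ Real.pi_pos.le]
    field_simp
    rw [hsx, h2]
    field_simp
  have hY : √x * hankelIm (1 / 2) x = -(√(2 / π) * Real.cos x) := by
    have h := hankelRe_neg (1 / 2) x
    rw [one_div_mul_eq_div, Real.cos_pi_div_two, Real.sin_pi_div_two, zero_mul, one_mul, zero_sub,
      hankelRe_eq_besselJ _ hx, besselJ_eq _ hx, besselEntire_neg_half, Real.rpow_neg (by positivity),
      ← Real.sqrt_eq_rpow, Real.sqrt_div' _ zero_le_two] at h
    rw [← neg_eq_iff_eq_neg.2 h.symm.symm, Real.sqrt_div' _ Real.pi_pos.le]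
    field_simp
  have hJ' : (√x * hankelRe (1 / 2) x : ℂ) = √(2 / π) * Complex.sin x := by exact_mod_cast hJ
  have hY' : (√x * hankelIm (1 / 2) x : ℂ) = -(√(2 / π) * Complex.cos x) := by exact_mod_cast hY
  have he : Complex.exp ((1 / 2 * (π / 2) : ℝ) * Complex.I) * -Complex.I =
      Complex.exp (-(π / 4) * Complex.I) := by
    have : -(π / 4) * Complex.I = (1 / 2 * (π / 2) : ℝ) * Complex.I + -(π / 2 * Complex.I) := by
      push_cast
      ring
    rw [this, Complex.exp_add, Complex.exp_neg (π / 2 * Complex.I), Complex.exp_pi_div_two_mul_I,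
      Complex.inv_I]
  rw [hankelHat, hankelFn_eq, hankelAmp, ← he, Complex.exp_mul_I (x : ℂ)]
  linear_combination Complex.exp ((1 / 2 * (π / 2) : ℝ) * Complex.I) * (hJ' + Complex.I * hY') +
    Complex.exp ((1 / 2 * (π / 2) : ℝ) * Complex.I) * √(2 / π) * Complex.sin x * Complex.I_sq

theorem tendsto_hankelHat (ν : ℝ) :
    Tendsto (fun x => hankelHat ν x - hankelAmp * Complex.exp (x * Complex.I)) atTop (nhds 0) := by
  refine (tendsto_hankelHat_sub ν (1 / 2)).congr' ?_
  filter_upwards [eventually_gt_atTop 0] with x hx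
  rw [hankelHat_half hx]

/-- `x` times the derivative of `hankelRe ν`. -/
noncomputable def hankelReDer (ν x : ℝ) : ℝ := ν * hankelRe ν x - x * hankelRe (ν + 1) x

/-- `x` times the derivative of `hankelIm ν`. -/
noncomputable def hankelImDer (ν x : ℝ) : ℝ := ν * hankelIm ν x - x * hankelIm (ν + 1) x

/-- `x` times the derivative of `hankelFn ν`. -/
noncomputable def hankelDer (ν x : ℝ) : ℂ := ν * hankelFn ν x - x * hankelFn (ν + 1) x

theorem isBesselSol_hankelRe (ν : ℝ) : IsBesselSol ν (hankelRe ν) (hankelReDer ν) :=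
  isCylinderFamily_hankelRe.isBesselSol ν

theorem isBesselSol_hankelIm (ν : ℝ) : IsBesselSol ν (hankelIm ν) (hankelImDer ν) :=
  isCylinderFamily_hankelIm.isBesselSol ν

theorem hankelDer_eq (ν x : ℝ) :
    hankelDer ν x = hankelReDer ν x + hankelImDer ν x * Complex.I := by
  rw [hankelDer, hankelFn_eq, hankelFn_eq, hankelReDer, hankelImDer]
  push_cast
  ring

/-- The rescaled derivative companion of `hankelHat`. -/
noncomputable def hankelHatDer (ν x : ℝ) : ℂ :=
  (√x : ℂ)⁻¹ * (Complex.exp ((ν * (π / 2) : ℝ) * Complex.I) * hankelDer ν x)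

theorem cexp_half_pi_succ (ν : ℝ) :
    Complex.exp (((ν + 1) * (π / 2) : ℝ) * Complex.I) =
      Complex.I * Complex.exp ((ν * (π / 2) : ℝ) * Complex.I) := by
  have : ((ν + 1) * (π / 2) : ℝ) * Complex.I =
      (π / 2 * Complex.I) + (ν * (π / 2) : ℝ) * Complex.I := by
    push_cast
    ring
  rw [this, Complex.exp_add, Complex.exp_pi_div_two_mul_I]

theorem hankelHatDer_eq (ν : ℝ) {x : ℝ} (hx : 0 < x) :
    hankelHatDer ν x = (ν / x : ℝ) * hankelHat ν x + Complex.I * hankelHat (ν + 1) x := by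
  have hs : (√x : ℂ) ^ 2 = x := by exact_mod_cast Real.sq_sqrt hx.le
  have hs0 : (√x : ℂ) ≠ 0 := by exact_mod_cast (Real.sqrt_pos.2 hx).ne'
  rw [hankelHatDer, hankelHat, hankelHat, hankelDer, cexp_half_pi_succ]
  push_cast
  rw [← hs]
  field_simp
  linear_combination (-(√x : ℂ) ^ 2 * hankelFn (ν + 1) x) * Complex.I_sq

theorem norm_hankelAmp_mul (x : ℝ) : ‖hankelAmp * Complex.exp (x * Complex.I)‖ = √(2 / π) := by
  have : -(π / 4 : ℂ) * Complex.I = (-(π / 4) : ℝ) * Complex.I := by push_cast; ring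
  rw [hankelAmp, this, norm_mul, norm_mul, Complex.norm_exp_ofReal_mul_I,
    Complex.norm_exp_ofReal_mul_I, Complex.norm_real, Real.norm_of_nonneg (Real.sqrt_nonneg _),
    mul_one, mul_one]

theorem tendsto_mul_sub_mul {a b c d : ℝ → ℂ} {M : ℝ}
    (h1 : Tendsto (fun x => a x - b x) atTop (nhds 0))
    (h2 : Tendsto (fun x => c x - d x) atTop (nhds 0))
    (hb : ∀ x, ‖b x‖ ≤ M) (hd : ∀ x, ‖d x‖ ≤ M) :
    Tendsto (fun x => a x * c x - b x * d x) atTop (nhds 0) := by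
  have hb' : IsBoundedUnder (· ≤ ·) atTop (norm ∘ b) :=
    isBoundedUnder_of_eventually_le (Filter.Eventually.of_forall hb)
  have hd' : IsBoundedUnder (· ≤ ·) atTop (norm ∘ d) :=
    isBoundedUnder_of_eventually_le (Filter.Eventually.of_forall hd)
  have h := ((h1.mul h2).add (h1.zero_mul_isBoundedUnder_le hd')).add
    (h2.zero_mul_isBoundedUnder_le hb')
  rw [mul_zero, add_zero, add_zero] at h
  refine h.congr fun x => ?_
  ring

theorem tendsto_hankelHatDer (ν : ℝ) :
    Tendsto (fun x => hankelHatDer ν x -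
      Complex.I * (hankelAmp * Complex.exp (x * Complex.I))) atTop (nhds 0) := by
  have h0 : Tendsto (fun x : ℝ => ((ν / x : ℝ) : ℂ)) atTop (nhds 0) := by
    have := (Complex.continuous_ofReal.tendsto 0).comp
      (tendsto_const_nhds.div_atTop tendsto_id : Tendsto (fun x : ℝ => ν / x) atTop (nhds 0))
    rw [Complex.ofReal_zero] at this
    exact this
  have hb : IsBoundedUnder (· ≤ ·) atTop
      (norm ∘ fun x : ℝ => hankelAmp * Complex.exp (x * Complex.I)) :=
    isBoundedUnder_of_eventually_le (Filter.Eventually.of_forall fun x =>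
      (norm_hankelAmp_mul x).le)
  have h := ((h0.mul (tendsto_hankelHat ν)).add (h0.zero_mul_isBoundedUnder_le hb)).add
    ((tendsto_hankelHat (ν + 1)).const_mul Complex.I)
  rw [mul_zero, mul_zero, add_zero, add_zero] at h
  refine h.congr' ?_
  filter_upwards [eventually_gt_atTop 0] with x hx
  rw [hankelHatDer_eq ν hx]
  ring

theorem conj_hankelAmp_mul (x : ℝ) :
    (starRingEnd ℂ) (hankelAmp * Complex.exp (x * Complex.I)) *
      (hankelAmp * Complex.exp (x * Complex.I)) = (2 / π : ℝ) := by
  rw [← Complex.normSq_eq_conj_mul_self, Complex.normSq_eq_norm_sq, norm_hankelAmp_mul,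
    Real.sq_sqrt (by positivity)]

theorem tendsto_conj_sub {a b : ℝ → ℂ} (h : Tendsto (fun x => a x - b x) atTop (nhds 0)) :
    Tendsto (fun x => (starRingEnd ℂ) (a x) - (starRingEnd ℂ) (b x)) atTop (nhds 0) := by
  have := (Complex.continuous_conj.tendsto 0).comp h
  rw [map_zero] at this
  exact this.congr fun x => by simp

/-- The squared modulus of the Hankel function. -/
noncomputable def hankelMod (ν x : ℝ) : ℝ := hankelRe ν x ^ 2 + hankelIm ν x ^ 2

/-- Half of `x` times the derivative of `hankelMod ν`. -/
noncomputable def hankelModDer (ν x : ℝ) : ℝ :=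
  hankelRe ν x * hankelReDer ν x + hankelIm ν x * hankelImDer ν x

/-- The squared modulus of `hankelDer`. -/
noncomputable def hankelDerMod (ν x : ℝ) : ℝ := hankelReDer ν x ^ 2 + hankelImDer ν x ^ 2

theorem conj_cexp_mul_I_mul (t : ℝ) :
    (starRingEnd ℂ) (Complex.exp (t * Complex.I)) * Complex.exp (t * Complex.I) = 1 := by
  rw [← Complex.normSq_eq_conj_mul_self, Complex.normSq_eq_norm_sq, Complex.norm_exp_ofReal_mul_I]
  norm_num

theorem tendsto_mul_hankelMod (ν : ℝ) :
    Tendsto (fun x => x * hankelMod ν x) atTop (nhds (2 / π)) := by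
  have h := tendsto_mul_sub_mul (M := √(2 / π)) (tendsto_conj_sub (tendsto_hankelHat ν))
    (tendsto_hankelHat ν) (fun x => by rw [RCLike.norm_conj, norm_hankelAmp_mul])
    (fun x => (norm_hankelAmp_mul x).le)
  simp only [conj_hankelAmp_mul] at h
  have h1 := (Complex.continuous_re.tendsto 0).comp h
  have h2 := h1.add_const (2 / π)
  rw [Complex.zero_re, zero_add] at h2
  refine h2.congr' ?_
  filter_upwards [eventually_gt_atTop 0] with x hx
  simp only [Function.comp, Complex.sub_re, Complex.ofReal_re, sub_add_cancel]
  rw [← Complex.normSq_eq_conj_mul_self, Complex.ofReal_re, hankelHat, Complex.normSq_mul,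
    Complex.normSq_mul, Complex.normSq_ofReal, Real.mul_self_sqrt hx.le,
    Complex.normSq_eq_norm_sq (Complex.exp _), Complex.norm_exp_ofReal_mul_I,
    Complex.normSq_apply, hankelMod, hankelRe, hankelIm]
  ring

theorem tendsto_hankelDerMod_div (ν : ℝ) :
    Tendsto (fun x => hankelDerMod ν x / x) atTop (nhds (2 / π)) := by
  have hn : ∀ x : ℝ, ‖Complex.I * (hankelAmp * Complex.exp (x * Complex.I))‖ = √(2 / π) :=
    fun x => by rw [norm_mul, Complex.norm_I, one_mul, norm_hankelAmp_mul]
  have h := tendsto_mul_sub_mul (M := √(2 / π)) (tendsto_conj_sub (tendsto_hankelHatDer ν))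
    (tendsto_hankelHatDer ν) (fun x => by rw [RCLike.norm_conj, hn]) (fun x => (hn x).le)
  have h1 := (Complex.continuous_re.tendsto 0).comp h
  have h2 := h1.add_const (2 / π)
  rw [Complex.zero_re, zero_add] at h2
  refine h2.congr' ?_
  filter_upwards [eventually_gt_atTop 0] with x hx
  have e1 : (starRingEnd ℂ) (Complex.I * (hankelAmp * Complex.exp (x * Complex.I))) *
      (Complex.I * (hankelAmp * Complex.exp (x * Complex.I))) = (2 / π : ℝ) := by
    rw [← Complex.normSq_eq_conj_mul_self, Complex.normSq_eq_norm_sq, hn,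
      Real.sq_sqrt (by positivity)]
  have e2 : Complex.normSq (hankelDer ν x) = hankelDerMod ν x := by
    rw [hankelDer_eq, Complex.normSq_add_mul_I, hankelDerMod]
  simp only [Function.comp]
  rw [e1, Complex.sub_re, Complex.ofReal_re, sub_add_cancel, ← Complex.normSq_eq_conj_mul_self,
    Complex.ofReal_re, hankelHatDer, Complex.normSq_mul, Complex.normSq_mul, Complex.normSq_inv,
    Complex.normSq_ofReal, Real.mul_self_sqrt hx.le, Complex.normSq_eq_norm_sq (Complex.exp _),
    Complex.norm_exp_ofReal_mul_I, e2]
  ring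

theorem tendsto_conj_hankelFn_mul (ν : ℝ) :
    Tendsto (fun x => (starRingEnd ℂ) (hankelFn ν x) * hankelDer ν x) atTop
      (nhds (Complex.I * (2 / π : ℝ))) := by
  have hn : ∀ x : ℝ, ‖Complex.I * (hankelAmp * Complex.exp (x * Complex.I))‖ ≤ √(2 / π) :=
    fun x => by rw [norm_mul, Complex.norm_I, one_mul, norm_hankelAmp_mul]
  have h := tendsto_mul_sub_mul (M := √(2 / π)) (tendsto_conj_sub (tendsto_hankelHat ν))
    (tendsto_hankelHatDer ν) (fun x => by rw [RCLike.norm_conj, norm_hankelAmp_mul]) hn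
  have h2 := h.add_const (Complex.I * (2 / π : ℝ))
  rw [zero_add] at h2
  refine h2.congr' ?_
  filter_upwards [eventually_gt_atTop 0] with x hx
  have hs0 : (√x : ℂ) ≠ 0 := by exact_mod_cast (Real.sqrt_pos.2 hx).ne'
  rw [mul_left_comm _ Complex.I, conj_hankelAmp_mul, sub_add_cancel, hankelHat, hankelHatDer,
    map_mul, map_mul, Complex.conj_ofReal]
  have e := conj_cexp_mul_I_mul (ν * (π / 2))
  have e1 : (√x : ℂ) * (√x : ℂ)⁻¹ = 1 := mul_inv_cancel₀ hs0
  linear_combination ((starRingEnd ℂ) (Complex.exp ((ν * (π / 2) : ℝ) * Complex.I)) *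
    Complex.exp ((ν * (π / 2) : ℝ) * Complex.I) *
    (starRingEnd ℂ) (hankelFn ν x) * hankelDer ν x) * e1 +
    ((starRingEnd ℂ) (hankelFn ν x) * hankelDer ν x) * e

theorem conj_hankelFn_mul_eq (ν x : ℝ) : (starRingEnd ℂ) (hankelFn ν x) * hankelDer ν x =
    hankelModDer ν x +
      (hankelRe ν x * hankelImDer ν x - hankelReDer ν x * hankelIm ν x : ℝ) * Complex.I := by
  rw [hankelFn_eq, hankelDer_eq, hankelModDer]
  simp only [map_add, map_mul, Complex.conj_ofReal, Complex.conj_I]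
  push_cast
  linear_combination (-(hankelIm ν x * hankelImDer ν x : ℂ)) * Complex.I_sq

theorem tendsto_hankelModDer (ν : ℝ) : Tendsto (hankelModDer ν) atTop (nhds 0) := by
  have h := (Complex.continuous_re.tendsto _).comp (tendsto_conj_hankelFn_mul ν)
  rw [Complex.I_mul_re, Complex.ofReal_im, neg_zero] at h
  refine h.congr fun x => ?_
  simp [Function.comp, conj_hankelFn_mul_eq]

theorem hankel_wronskian (ν : ℝ) {x : ℝ} (hx : 0 < x) :
    hankelRe ν x * hankelImDer ν x - hankelReDer ν x * hankelIm ν x = 2 / π := by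
  have h := (Complex.continuous_im.tendsto _).comp (tendsto_conj_hankelFn_mul ν)
  rw [Complex.I_mul_im, Complex.ofReal_re] at h
  refine tendsto_nhds_unique (tendsto_const_nhds.congr' ?_) h
  filter_upwards [eventually_gt_atTop 0] with y hy
  rw [Function.comp, conj_hankelFn_mul_eq, Complex.add_im, Complex.ofReal_im, zero_add,
    Complex.im_ofReal_mul, Complex.I_im, mul_one]
  exact eq_of_hasDerivAt_zero (fun z hz =>
    (isBesselSol_hankelRe ν).hasDerivAt_wronskian (isBesselSol_hankelIm ν) hz) hx hy

theorem hasDerivAt_hankelMod (ν : ℝ) {x : ℝ} (hx : 0 < x) :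
    HasDerivAt (hankelMod ν) (2 * hankelModDer ν x / x) x := by
  refine ((((isBesselSol_hankelRe ν).hasDerivAt_fst x hx).pow 2).add
    (((isBesselSol_hankelIm ν).hasDerivAt_fst x hx).pow 2)).congr_deriv ?_
  simp only [hankelModDer, Nat.cast_ofNat]
  ring

theorem hasDerivAt_hankelModDer (ν : ℝ) {x : ℝ} (hx : 0 < x) :
    HasDerivAt (hankelModDer ν)
      (hankelDerMod ν x / x - (x - ν ^ 2 / x) * hankelMod ν x) x := by
  have hA := isBesselSol_hankelRe ν
  have hB := isBesselSol_hankelIm ν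
  refine (((hA.hasDerivAt_fst x hx).mul (hA.hasDerivAt_snd x hx)).add
    ((hB.hasDerivAt_fst x hx).mul (hB.hasDerivAt_snd x hx))).congr_deriv ?_
  simp only [hankelMod, hankelDerMod]
  ring

theorem hasDerivAt_hankelDerMod (ν : ℝ) {x : ℝ} (hx : 0 < x) :
    HasDerivAt (hankelDerMod ν) (-2 * (x - ν ^ 2 / x) * hankelModDer ν x) x := by
  refine ((((isBesselSol_hankelRe ν).hasDerivAt_snd x hx).pow 2).add
    (((isBesselSol_hankelIm ν).hasDerivAt_snd x hx).pow 2)).congr_deriv ?_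
  simp only [hankelModDer, Nat.cast_ofNat]
  ring

theorem hankelMod_sub (ν : ℝ) {x : ℝ} (hx : 0 < x) :
    hankelMod (ν - 1) x - hankelMod (ν + 1) x = 4 * ν * hankelModDer ν x / x ^ 2 := by
  simp only [hankelMod, hankelModDer, hankelReDer, hankelImDer]
  rw [isCylinderFamily_hankelRe.sub_one ν x hx, isCylinderFamily_hankelIm.sub_one ν x hx]
  field_simp
  ring

theorem tendsto_hankelMod (ν : ℝ) : Tendsto (hankelMod ν) atTop (nhds 0) := by
  have h := (tendsto_mul_hankelMod ν).mul tendsto_inv_atTop_zero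
  rw [mul_zero] at h
  refine h.congr' ?_
  filter_upwards [eventually_gt_atTop 0] with x hx
  field_simp

/-- A function whose derivative is `o(x⁻²)` and which vanishes at infinity is `o(x⁻¹)`. -/
theorem tendsto_mul_zero_of_deriv {f f' : ℝ → ℝ} (hf : ∀ x, 0 < x → HasDerivAt f (f' x) x)
    (h0 : Tendsto f atTop (nhds 0)) (h1 : Tendsto (fun x => x ^ 2 * f' x) atTop (nhds 0)) :
    Tendsto (fun x => x * f x) atTop (nhds 0) := by
  have h := HasDerivAt.lhopital_zero_atTop (f := f) (f' := f') (g := fun x => x⁻¹)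
    (g' := fun x => -(x ^ 2)⁻¹) (l := nhds 0)
    (by filter_upwards [eventually_gt_atTop 0] with x hx using hf x hx)
    (by filter_upwards [eventually_gt_atTop 0] with x hx using hasDerivAt_inv hx.ne')
    (by
      filter_upwards [eventually_gt_atTop 0] with x hx
      exact neg_ne_zero.2 (inv_ne_zero (pow_ne_zero 2 hx.ne')))
    h0 tendsto_inv_atTop_zero
    (by
      have := h1.neg
      rw [neg_zero] at this
      refine this.congr fun x => ?_
      rw [div_neg, div_inv_eq_mul, mul_comm])
  refine h.congr fun x => ?_
  rw [div_inv_eq_mul, mul_comm]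

theorem tendsto_mul_hankelMod_add (ν : ℝ) :
    Tendsto (fun x => x * (hankelMod ν x + 2 * hankelModDer ν x)) atTop (nhds 0) := by
  set v : ℝ → ℝ := fun x => hankelMod ν x + 2 * hankelModDer ν x with hv
  set z : ℝ → ℝ := fun x => 2 * hankelModDer ν x / x +
    2 * (hankelDerMod ν x / x - (x - ν ^ 2 / x) * hankelMod ν x) with hz
  have hv' : ∀ x, 0 < x → HasDerivAt v (z x) x := fun x hx =>
    (hasDerivAt_hankelMod ν hx).add ((hasDerivAt_hankelModDer ν hx).const_mul 2)
  have hz' : ∀ x, 0 < x → HasDerivAt z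
      (-4 * v x + (8 * ν ^ 2 - 2) * hankelModDer ν x / x ^ 2) x := fun x hx => by
    have hi := hasDerivAt_id x
    refine ((((hasDerivAt_hankelModDer ν hx).const_mul 2).div hi hx.ne').add
      ((((hasDerivAt_hankelDerMod ν hx).div hi hx.ne').sub ((hi.sub
        ((hasDerivAt_const x (ν ^ 2)).div hi hx.ne')).mul
          (hasDerivAt_hankelMod ν hx))).const_mul 2)).congr_deriv ?_
    simp only [hv, id, Pi.sub_apply, Pi.div_apply]
    field_simp
    ring
  have hn := tendsto_hankelModDer ν
  have hp := tendsto_hankelMod ν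
  have hv0 : Tendsto v atTop (nhds 0) := by
    have := hp.add (hn.const_mul 2)
    rw [mul_zero, add_zero] at this
    exact this
  have hz0 : Tendsto z atTop (nhds 0) := by
    have h1 := (((hn.const_mul 2).mul tendsto_inv_atTop_zero).add
      (((tendsto_hankelDerMod_div ν).sub (tendsto_mul_hankelMod ν)).const_mul 2)).add
        (((hp.mul tendsto_inv_atTop_zero).const_mul (ν ^ 2)).const_mul 2)
    simp only [mul_zero, sub_self, add_zero] at h1
    refine h1.congr fun x => ?_
    simp only [hz]
    ring
  have hd2 : ∀ x : ℝ, HasDerivAt (fun y : ℝ => 2 * y) 2 x := fun x => by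
    simpa using (hasDerivAt_id x).const_mul 2
  have hcb : IsBoundedUnder (· ≤ ·) atTop (norm ∘ fun x : ℝ => Real.cos (2 * x)) :=
    isBoundedUnder_of_eventually_le (Filter.Eventually.of_forall fun x => Real.abs_cos_le_one _)
  have hsb : IsBoundedUnder (· ≤ ·) atTop (norm ∘ fun x : ℝ => Real.sin (2 * x)) :=
    isBoundedUnder_of_eventually_le (Filter.Eventually.of_forall fun x => Real.abs_sin_le_one _)
  have hn0 : Tendsto (fun x => (4 * ν ^ 2 - 1) * hankelModDer ν x) atTop (nhds 0) := by
    have := hn.const_mul (4 * ν ^ 2 - 1)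
    rwa [mul_zero] at this
  have hz2 : Tendsto (fun x => z x / 2) atTop (nhds 0) := by
    have := hz0.div_const 2
    rwa [zero_div] at this
  have hc1 : Tendsto (fun x => x * (v x * Real.cos (2 * x) - z x / 2 * Real.sin (2 * x)))
      atTop (nhds 0) := by
    refine tendsto_mul_zero_of_deriv (f' := fun x => -((4 * ν ^ 2 - 1) * hankelModDer ν x / x ^ 2 *
      Real.sin (2 * x))) (fun x hx => ?_) ?_ ?_
    · refine (((hv' x hx).mul (hd2 x).cos).sub
        (((hz' x hx).div_const 2).mul (hd2 x).sin)).congr_deriv ?_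
      ring
    · have := (hv0.zero_mul_isBoundedUnder_le hcb).sub (hz2.zero_mul_isBoundedUnder_le hsb)
      rwa [sub_zero] at this
    · have := (hn0.zero_mul_isBoundedUnder_le hsb).neg
      rw [neg_zero] at this
      refine this.congr' ?_
      filter_upwards [eventually_gt_atTop 0] with x hx
      field_simp
  have hs1 : Tendsto (fun x => x * (v x * Real.sin (2 * x) + z x / 2 * Real.cos (2 * x)))
      atTop (nhds 0) := by
    refine tendsto_mul_zero_of_deriv (f' := fun x => ((4 * ν ^ 2 - 1) * hankelModDer ν x / x ^ 2 *
      Real.cos (2 * x))) (fun x hx => ?_) ?_ ?_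
    · refine (((hv' x hx).mul (hd2 x).sin).add
        (((hz' x hx).div_const 2).mul (hd2 x).cos)).congr_deriv ?_
      ring
    · have := (hv0.zero_mul_isBoundedUnder_le hsb).add (hz2.zero_mul_isBoundedUnder_le hcb)
      rwa [add_zero] at this
    · have := (hn0.zero_mul_isBoundedUnder_le hcb)
      refine this.congr' ?_
      filter_upwards [eventually_gt_atTop 0] with x hx
      field_simp
  have h := (hc1.zero_mul_isBoundedUnder_le hcb).add (hs1.zero_mul_isBoundedUnder_le hsb)
  rw [add_zero] at h
  refine h.congr fun x => ?_
  linear_combination (x * v x) * Real.sin_sq_add_cos_sq (2 * x)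

theorem eventually_hankelModDer_neg (ν : ℝ) : ∀ᶠ x in atTop, hankelModDer ν x < 0 := by
  have h := (tendsto_mul_hankelMod_add ν).sub (tendsto_mul_hankelMod ν)
  have hneg : (0 : ℝ) - 2 / π < 0 := by
    have : 0 < 2 / π := by positivity
    linarith
  filter_upwards [h.eventually (gt_mem_nhds hneg), eventually_gt_atTop 0] with x h1 hx
  nlinarith

theorem hankelMod_nonneg (ν x : ℝ) : 0 ≤ hankelMod ν x := by
  unfold hankelMod
  positivity

theorem comb_sq_le (a b c d : ℝ) : (a * c + b * d) ^ 2 ≤ (a ^ 2 + b ^ 2) * (c ^ 2 + d ^ 2) := by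
  nlinarith [sq_nonneg (a * d - b * c)]

theorem tendsto_comparison_aux {k m a b : ℝ} {y y₁ : ℝ → ℝ}
    (hy : ∀ x, y x = a * hankelRe k x + b * hankelIm k x)
    (hy₁ : ∀ x, y₁ x = a * hankelReDer k x + b * hankelImDer k x) :
    Tendsto (fun x => Complex.normSq (y x * hankelDer m x - y₁ x * hankelFn m x)) atTop
      (nhds ((2 / π) ^ 2 * (a ^ 2 + b ^ 2))) := by
  have hb : IsBoundedUnder (· ≤ ·) atTop (norm ∘ fun x : ℝ => ((y x * √x : ℝ) : ℂ)) := by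
    refine isBoundedUnder_of_eventually_le (a := √((a ^ 2 + b ^ 2) * (2 / π + 1))) ?_
    filter_upwards [(tendsto_mul_hankelMod k).eventually (gt_mem_nhds (lt_add_one (2 / π))),
      eventually_gt_atTop 0] with x h1 hx
    rw [Function.comp, Complex.norm_real]
    refine Real.abs_le_sqrt ?_
    rw [mul_pow, Real.sq_sqrt hx.le, hy]
    have h2 := comb_sq_le a b (hankelRe k x) (hankelIm k x)
    rw [← hankelMod] at h2
    nlinarith [mul_le_mul_of_nonneg_left h1.le (by positivity : 0 ≤ a ^ 2 + b ^ 2)]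
  have hb₁ : IsBoundedUnder (· ≤ ·) atTop (norm ∘ fun x : ℝ => ((y₁ x * (√x)⁻¹ : ℝ) : ℂ)) := by
    refine isBoundedUnder_of_eventually_le (a := √((a ^ 2 + b ^ 2) * (2 / π + 1))) ?_
    filter_upwards [(tendsto_hankelDerMod_div k).eventually (gt_mem_nhds (lt_add_one (2 / π))),
      eventually_gt_atTop 0] with x h1 hx
    rw [Function.comp, Complex.norm_real]
    refine Real.abs_le_sqrt ?_
    rw [mul_pow, inv_pow, Real.sq_sqrt hx.le, hy₁]
    have h2 := comb_sq_le a b (hankelReDer k x) (hankelImDer k x)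
    rw [← hankelDerMod] at h2
    calc _ ≤ (a ^ 2 + b ^ 2) * hankelDerMod k x * x⁻¹ :=
          mul_le_mul_of_nonneg_right h2 (by positivity)
      _ = (a ^ 2 + b ^ 2) * (hankelDerMod k x / x) := by ring
      _ ≤ _ := mul_le_mul_of_nonneg_left h1.le (by positivity)
  have hd : Tendsto (fun x => hankelHatDer m x - hankelHatDer k x) atTop (nhds 0) := by
    have := (tendsto_hankelHatDer m).sub (tendsto_hankelHatDer k)
    rw [sub_zero] at this
    exact this.congr fun x => by ring
  have h := (hd.zero_mul_isBoundedUnder_le hb).sub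
    ((tendsto_hankelHat_sub m k).zero_mul_isBoundedUnder_le hb₁)
  rw [sub_zero] at h
  have h1 := h.add_const
    (Complex.exp ((k * (π / 2) : ℝ) * Complex.I) * ((2 / π : ℝ) * (a * Complex.I - b)))
  rw [zero_add] at h1
  have h2 := (Complex.continuous_normSq.tendsto _).comp h1
  rw [Complex.normSq_mul, Complex.normSq_eq_norm_sq (Complex.exp _),
    Complex.norm_exp_ofReal_mul_I, Complex.normSq_mul, Complex.normSq_ofReal] at h2
  have e0 : Complex.normSq (a * Complex.I - b) = a ^ 2 + b ^ 2 := by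
    rw [Complex.normSq_apply]
    simp
    ring
  rw [e0, one_pow, one_mul, ← sq] at h2
  refine h2.congr' ?_
  filter_upwards [eventually_gt_atTop 0] with x hx
  have hs0 : (√x : ℂ) ≠ 0 := by exact_mod_cast (Real.sqrt_pos.2 hx).ne'
  have hG : y x * hankelDer k x - y₁ x * hankelFn k x = (2 / π : ℝ) * (a * Complex.I - b) := by
    rw [← hankel_wronskian k hx, hy, hy₁, hankelDer_eq, hankelFn_eq]
    push_cast
    ring
  have e1 : (√x : ℂ) * (√x : ℂ)⁻¹ = 1 := mul_inv_cancel₀ hs0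
  rw [Function.comp, ← hG]
  have : (hankelHatDer m x - hankelHatDer k x) * ((y x * √x : ℝ) : ℂ) -
      (hankelHat m x - hankelHat k x) * ((y₁ x * (√x)⁻¹ : ℝ) : ℂ) +
      Complex.exp ((k * (π / 2) : ℝ) * Complex.I) *
        (y x * hankelDer k x - y₁ x * hankelFn k x) =
      Complex.exp ((m * (π / 2) : ℝ) * Complex.I) *
        (y x * hankelDer m x - y₁ x * hankelFn m x) := by
    simp only [hankelHat, hankelHatDer, Complex.ofReal_mul, Complex.ofReal_inv]
    field_simp
    ring
  rw [this, Complex.normSq_mul, Complex.normSq_eq_norm_sq (Complex.exp _),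
    Complex.norm_exp_ofReal_mul_I, one_pow, one_mul]

theorem tendsto_comparison {k m a b : ℝ} {y y₁ : ℝ → ℝ}
    (hy : ∀ x, y x = a * hankelRe k x + b * hankelIm k x)
    (hy₁ : ∀ x, y₁ x = a * hankelReDer k x + b * hankelImDer k x) :
    Tendsto (fun x => (y x * hankelReDer m x - y₁ x * hankelRe m x) ^ 2 +
      (y x * hankelImDer m x - y₁ x * hankelIm m x) ^ 2 +
      (m ^ 2 - k ^ 2) * (y x ^ 2 * hankelMod m x)) atTop
      (nhds ((2 / π) ^ 2 * (a ^ 2 + b ^ 2))) := by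
  have h0 : Tendsto (fun x => y x ^ 2 * hankelMod m x) atTop (nhds 0) := by
    have h1 := ((tendsto_hankelMod k).mul (tendsto_hankelMod m)).const_mul (a ^ 2 + b ^ 2)
    rw [mul_zero, mul_zero] at h1
    refine squeeze_zero (fun x => mul_nonneg (sq_nonneg _) (hankelMod_nonneg m x)) (fun x => ?_) h1
    rw [← mul_assoc, hy]
    exact mul_le_mul_of_nonneg_right (comb_sq_le _ _ _ _) (hankelMod_nonneg m x)
  have h := (tendsto_comparison_aux (m := m) hy hy₁).add (h0.const_mul (m ^ 2 - k ^ 2))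
  rw [mul_zero, add_zero] at h
  refine h.congr fun x => ?_
  congr 1
  rw [hankelDer_eq, hankelFn_eq, ← Complex.normSq_add_mul_I]
  congr 1
  push_cast
  ring

/-- If `(m² - k²) σ` times the derivative of the modulus of order `m` is positive beyond `x₀`,
the moduli of orders `m` and `k` at `x₀` compare accordingly. -/
theorem hankelMod_lt_of_modDer {k m σ x₀ : ℝ} (hx₀ : 0 < x₀)
    (h : ∀ x, x₀ < x → 0 < σ * ((m ^ 2 - k ^ 2) * hankelModDer m x)) :
    σ * hankelMod m x₀ < σ * hankelMod k x₀ := by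
  set y : ℝ → ℝ := fun x => -hankelIm k x₀ * hankelRe k x + hankelRe k x₀ * hankelIm k x with hy
  set y₁ : ℝ → ℝ := fun x => -hankelIm k x₀ * hankelReDer k x + hankelRe k x₀ * hankelImDer k x
    with hy₁
  have hsol : IsBesselSol k y y₁ :=
    (isBesselSol_hankelRe k).comb (isBesselSol_hankelIm k) _ _
  have hA := isBesselSol_hankelRe m
  have hB := isBesselSol_hankelIm m
  have hlim := tendsto_comparison (k := k) (m := m) (y := y) (y₁ := y₁) (fun _ => rfl)
    (fun _ => rfl)
  set E : ℝ → ℝ := fun x => (y x * hankelReDer m x - y₁ x * hankelRe m x) ^ 2 +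
      (y x * hankelImDer m x - y₁ x * hankelIm m x) ^ 2 +
      (m ^ 2 - k ^ 2) * (y x ^ 2 * hankelMod m x) with hE
  have hE' : ∀ x, 0 < x → HasDerivAt (fun x => σ * E x)
      (4 * y x ^ 2 / x * (σ * ((m ^ 2 - k ^ 2) * hankelModDer m x))) x := fun x hx => by
    have hu := hsol.hasDerivAt_fst x hx
    have hw := hsol.hasDerivAt_snd x hx
    refine (((((hu.mul (hA.hasDerivAt_snd x hx)).sub (hw.mul (hA.hasDerivAt_fst x hx))).pow 2).add
      (((hu.mul (hB.hasDerivAt_snd x hx)).sub (hw.mul (hB.hasDerivAt_fst x hx))).pow 2)).add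
        (((hu.pow 2).mul (hasDerivAt_hankelMod m hx)).const_mul
          (m ^ 2 - k ^ 2))).const_mul σ |>.congr_deriv ?_
    simp only [Pi.mul_apply, Pi.sub_apply, Pi.pow_apply, hankelModDer, hankelMod, Nat.cast_ofNat]
    field_simp
    ring
  have hy0 : y x₀ = 0 := by
    simp only [hy]
    ring
  have hy10 : y₁ x₀ = 2 / π := by
    rw [← hankel_wronskian k hx₀]
    simp only [hy₁]
    ring
  have hE0 : E x₀ = (2 / π) ^ 2 * hankelMod m x₀ := by
    simp only [hE, hy0, hy10, hankelMod]
    ring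
  have hne := (hsol.hasDerivAt_fst x₀ hx₀).eventually_ne (c := 0)
    (by rw [hy10]; positivity)
  have hne' := hne.filter_mono (nhdsWithin_mono x₀ fun z (hz : x₀ < z) => hz.ne')
  obtain ⟨c, hc, hcy⟩ := (mem_nhdsGT_iff_exists_Ioc_subset).1 hne'
  have h1 : σ * E x₀ < σ * E c := by
    refine lt_of_hasDerivAt_pos (f := fun x => σ * E x) hc (fun x hx => hE' x (hx₀.trans_le hx.1)) fun x hx => ?_
    have hx0 : 0 < x := hx₀.trans hx.1
    have : y x ≠ 0 := hcy ⟨hx.1, hx.2.le⟩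
    have := h x hx.1
    positivity
  have h2 : σ * E c ≤ σ * ((2 / π) ^ 2 * ((-hankelIm k x₀) ^ 2 + hankelRe k x₀ ^ 2)) := by
    refine ge_of_tendsto (hlim.const_mul σ) ?_
    filter_upwards [eventually_ge_atTop c] with z hz
    refine le_of_hasDerivAt_nonneg (f := fun x => σ * E x) hz (fun x hx => hE' x (hx₀.trans_le ((le_of_lt hc).trans hx.1)))
      fun x hx => ?_
    have hx0 : 0 < x := hx₀.trans (lt_trans hc hx.1)
    have := h x (lt_trans hc hx.1)
    positivity
  have h3 := h1.trans_le h2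
  rw [hE0, neg_sq, add_comm, ← hankelMod, mul_left_comm, mul_left_comm σ] at h3
  exact lt_of_mul_lt_mul_left h3 (by positivity)

theorem hankelModDer_neg {ν x : ℝ} (hν : 0 < ν) (hx : 0 < x) : hankelModDer ν x < 0 := by
  obtain ⟨X, hX⟩ := eventually_atTop.1
    ((eventually_hankelModDer_neg ν).and (eventually_hankelModDer_neg (ν + 1)))
  by_contra! hbad
  have hXx : x ≤ X := by
    by_contra! h
    exact absurd (hX x h.le).1 hbad.not_gt
  set S : Set ℝ := {z ∈ Set.Icc x X | 0 ≤ max (hankelModDer ν z) (hankelModDer (ν + 1) z)} with hS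
  have hcont : ContinuousOn (fun z => max (hankelModDer ν z) (hankelModDer (ν + 1) z))
      (Set.Icc x X) := fun z hz =>
    ContinuousAt.continuousWithinAt
      ((hasDerivAt_hankelModDer ν (hx.trans_le hz.1)).continuousAt.max
        (hasDerivAt_hankelModDer (ν + 1) (hx.trans_le hz.1)).continuousAt)
  have hScl : IsCompact S :=
    isCompact_Icc.of_isClosed_subset (hcont.preimage_isClosed_of_isClosed isClosed_Icc isClosed_Ici)
      fun z hz => hz.1
  have hSne : S.Nonempty := ⟨x, ⟨le_rfl, hXx⟩, le_max_of_le_left hbad⟩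
  obtain ⟨t, htS, ht⟩ := hScl.exists_isGreatest hSne
  have ht0 : 0 < t := hx.trans_le htS.1.1
  have hgood : ∀ z, t < z → hankelModDer ν z < 0 ∧ hankelModDer (ν + 1) z < 0 := fun z hz => by
    rcases le_total X z with h | h
    · exact hX z h
    · by_contra hcon
      refine absurd (ht (a := z) ⟨⟨htS.1.1.trans hz.le, h⟩, ?_⟩) hz.not_ge
      rw [le_max_iff]
      by_contra! hcon'
      exact hcon hcon'
  have h1 : hankelModDer ν t < 0 := by
    have := hankelMod_lt_of_modDer (k := ν - 1) (m := ν + 1) (σ := -1) ht0 fun z hz => by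
      have := (hgood z hz).2
      nlinarith [mul_pos hν (neg_pos.2 this)]
    have h2 := hankelMod_sub ν ht0
    have h3 : 4 * ν * hankelModDer ν t / t ^ 2 < 0 := by linarith
    rw [div_neg_iff] at h3
    rcases h3 with h3 | h3
    · exact absurd h3.2 (not_lt.2 (sq_nonneg t))
    · nlinarith
  have h1' : hankelModDer (ν + 1) t < 0 := by
    have := hankelMod_lt_of_modDer (k := ν + 2) (m := ν) (σ := 1) ht0 fun z hz => by
      have := (hgood z hz).1
      nlinarith [mul_pos hν (neg_pos.2 this)]
    have h2 := hankelMod_sub (ν + 1) ht0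
    rw [add_sub_cancel_right, add_assoc, one_add_one_eq_two] at h2
    have h3 : 4 * (ν + 1) * hankelModDer (ν + 1) t / t ^ 2 < 0 := by linarith
    rw [div_neg_iff] at h3
    rcases h3 with h3 | h3
    · exact absurd h3.2 (not_lt.2 (sq_nonneg t))
    · nlinarith
  exact absurd htS.2 (max_lt h1 h1').not_ge

theorem hankelMod_lt_hankelMod {a b x : ℝ} (ha : 0 ≤ a) (hab : a < b) (hx : 0 < x) :
    hankelMod a x < hankelMod b x := by
  have := hankelMod_lt_of_modDer (k := a) (m := b) (σ := -1) hx fun z hz => by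
    have := hankelModDer_neg (ha.trans_lt hab) (hx.trans hz)
    nlinarith [mul_pos (mul_pos (sub_pos.2 hab) (by linarith : 0 < b + a)) (neg_pos.2 this)]
  linarith

theorem IsBesselSol.continuousOn_snd {ν : ℝ} {u w : ℝ → ℝ} (h : IsBesselSol ν u w) :
    ContinuousOn w (Set.Ioi 0) := fun x hx =>
  (h.hasDerivAt_snd x hx).continuousAt.continuousWithinAt

theorem IsBesselSol.continuousOn_fst {ν : ℝ} {u w : ℝ → ℝ} (h : IsBesselSol ν u w) :
    ContinuousOn u (Set.Ioi 0) := fun x hx =>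
  (h.hasDerivAt_fst x hx).continuousAt.continuousWithinAt

theorem IsBesselSol.neg {ν : ℝ} {u w : ℝ → ℝ} (h : IsBesselSol ν u w) :
    IsBesselSol ν (fun x => -u x) (fun x => -w x) where
  hasDerivAt_fst x hx := (h.hasDerivAt_fst x hx).neg.congr_deriv (by ring)
  hasDerivAt_snd x hx := (h.hasDerivAt_snd x hx).neg.congr_deriv (by ring)

theorem forall_pos_or_forall_neg {f : ℝ → ℝ} {s : Set ℝ} (hs : s.OrdConnected)
    (hf : ContinuousOn f s) (h : ∀ x ∈ s, f x ≠ 0) :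
    (∀ x ∈ s, 0 < f x) ∨ ∀ x ∈ s, f x < 0 := by
  by_contra! hcon
  obtain ⟨⟨x, hx, hx0⟩, y, hy, hy0⟩ := hcon
  obtain ⟨t, ht, ht0⟩ := hs.isPreconnected.intermediate_value hx hy hf ⟨hx0, hy0⟩
  exact h t ht ht0

theorem forall_pos_of_eventually_pos {f : ℝ → ℝ} {s : Set ℝ} (hs : s.OrdConnected)
    (hsub : s ⊆ Set.Ioi 0) (hs0 : s ∈ nhdsWithin (0 : ℝ) (Set.Ioi 0))
    (hf : ContinuousOn f (Set.Ioi 0)) (h0 : ∀ᶠ x in nhdsWithin (0 : ℝ) (Set.Ioi 0), 0 < f x)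
    (h : ∀ x ∈ s, f x ≠ 0) : ∀ x ∈ s, 0 < f x := by
  refine (forall_pos_or_forall_neg hs (hf.mono hsub) h).resolve_right fun hneg => ?_
  obtain ⟨x, hx, hxs⟩ := (h0.and hs0).exists
  exact (hneg x hxs).not_gt hx

theorem exists_first_zero {f : ℝ → ℝ} {t : ℝ} (ht : 0 < t) (hf : ContinuousOn f (Set.Ioi 0))
    (h0 : ∀ᶠ x in nhdsWithin (0 : ℝ) (Set.Ioi 0), 0 < f x) (hft : f t ≤ 0) :
    ∃ c, 0 < c ∧ c ≤ t ∧ f c = 0 ∧ ∀ x ∈ Set.Ioo 0 c, 0 < f x := by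
  obtain ⟨r, hr, hrf⟩ := (mem_nhdsGT_iff_exists_Ioc_subset).1 h0
  have hr0 : 0 < r := hr
  have hrt : r < t := by
    by_contra! h
    exact (hrf ⟨ht, h⟩ : 0 < f t).not_ge hft
  have hc := hf.mono (fun x (hx : x ∈ Set.Icc r t) => hr0.trans_le hx.1)
  have hcpt : IsCompact (Set.Icc r t ∩ f ⁻¹' Set.Iic 0) :=
    isCompact_Icc.of_isClosed_subset (hc.preimage_isClosed_of_isClosed isClosed_Icc isClosed_Iic)
      Set.inter_subset_left
  obtain ⟨c, ⟨hcI, hc0⟩, hcl⟩ := hcpt.exists_isLeast ⟨t, ⟨hrt.le, le_rfl⟩, hft⟩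
  have hpos : ∀ x ∈ Set.Ioo 0 c, 0 < f x := fun x hx => by
    rcases le_total x r with h | h
    · exact hrf ⟨hx.1, h⟩
    · by_contra! hcon
      exact hx.2.not_ge (hcl ⟨⟨h, hx.2.le.trans hcI.2⟩, hcon⟩)
  have hcpos := hr0.trans_le hcI.1
  refine ⟨c, hcpos, hcI.2, le_antisymm hc0 ?_, hpos⟩
  have hlim : Tendsto f (nhdsWithin c (Set.Iio c)) (nhds (f c)) :=
    ((hf c hcpos).continuousAt (Ioi_mem_nhds hcpos)).tendsto.mono_left nhdsWithin_le_nhds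
  refine ge_of_tendsto hlim ?_
  filter_upwards [Ioo_mem_nhdsLT hcpos] with x hx using (hpos x hx).le

theorem nonneg_of_forall_Ioo_left {f : ℝ → ℝ} {c d : ℝ} (hcd : c < d) (hf : ContinuousAt f d)
    (h : ∀ x ∈ Set.Ioo c d, 0 ≤ f x) : 0 ≤ f d := by
  refine ge_of_tendsto (hf.tendsto.mono_left (nhdsWithin_le_nhds (s := Set.Iio d))) ?_
  filter_upwards [Ioo_mem_nhdsLT hcd] with x hx using h x hx

theorem deriv_nonpos_of_le_left {f : ℝ → ℝ} {c d f' : ℝ} (hcd : c < d) (hf : HasDerivAt f f' d)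
    (h : ∀ x ∈ Set.Ioo c d, f d ≤ f x) : f' ≤ 0 := by
  have ht := (hasDerivAt_iff_tendsto_slope.1 hf).mono_left
    (nhdsWithin_mono d fun z (hz : z ∈ Set.Iio d) => ne_of_lt hz)
  refine le_of_tendsto ht ?_
  filter_upwards [Ioo_mem_nhdsLT hcd] with x hx
  rw [slope_def_field]
  exact div_nonpos_of_nonneg_of_nonpos (sub_nonneg.2 (h x hx)) (sub_nonpos.2 hx.2.le)

theorem deriv_nonneg_of_le_right {f : ℝ → ℝ} {c d f' : ℝ} (hcd : c < d) (hf : HasDerivAt f f' c)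
    (h : ∀ x ∈ Set.Ioo c d, f c ≤ f x) : 0 ≤ f' := by
  have ht := (hasDerivAt_iff_tendsto_slope.1 hf).mono_left
    (nhdsWithin_mono c fun z (hz : z ∈ Set.Ioi c) => ne_of_gt hz)
  refine ge_of_tendsto ht ?_
  filter_upwards [Ioo_mem_nhdsGT hcd] with x hx
  rw [slope_def_field]
  exact div_nonneg (sub_nonneg.2 (h x hx)) (sub_nonneg.2 hx.1.le)

theorem deriv_mul_deriv_nonpos {f f' : ℝ → ℝ} {c d : ℝ} (hcd : c < d)
    (hf : ∀ x ∈ Set.Icc c d, HasDerivAt f (f' x) x) (hc : f c = 0) (hd : f d = 0)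
    (h : ∀ x ∈ Set.Ioo c d, f x ≠ 0) : f' c * f' d ≤ 0 := by
  have hfc := hf c (Set.left_mem_Icc.2 hcd.le)
  have hfd := hf d (Set.right_mem_Icc.2 hcd.le)
  rcases forall_pos_or_forall_neg Set.ordConnected_Ioo
    (fun x hx => (hf x (Set.Ioo_subset_Icc_self hx)).continuousAt.continuousWithinAt) h with hp | hp
  · exact mul_nonpos_of_nonneg_of_nonpos
      (deriv_nonneg_of_le_right hcd hfc fun x hx => hc.trans_le (hp x hx).le)
      (deriv_nonpos_of_le_left hcd hfd fun x hx => hd.trans_le (hp x hx).le)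
  · have h1 := deriv_nonneg_of_le_right hcd hfc.neg fun x hx => by
      simpa [hc] using (hp x hx).le
    have h2 := deriv_nonpos_of_le_left hcd hfd.neg fun x hx => by
      simpa [hd] using (hp x hx).le
    nlinarith

theorem IsBesselSol.fst_ne_zero {ν c : ℝ} {u w : ℝ → ℝ} (h : IsBesselSol ν u w) (hc : 0 < c)
    (hw : w c = 0) (hne : ∃ x, 0 < x ∧ w x ≠ 0) : u c ≠ 0 := fun hu => by
  obtain ⟨x, hx, hwx⟩ := hne
  have hz : ∀ y, 0 < y → u y = 0 := fun y hy => h.eq_zero_of_initial hc hu hw hy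
  have h1 : HasDerivAt u 0 x := (hasDerivAt_const x (0 : ℝ)).congr_of_eventuallyEq (by
    filter_upwards [Ioi_mem_nhds hx] with y hy using hz y hy)
  have := (h.hasDerivAt_fst x hx).unique h1
  rw [div_eq_zero_iff] at this
  exact this.elim hwx hx.ne'

theorem IsBesselSol.fst_pos_of_snd_pos_left {ν c d : ℝ} {u w : ℝ → ℝ} (h : IsBesselSol ν u w)
    (hν : 0 ≤ ν) (hνd : ν < d) (hc : 0 ≤ c) (hcd : c < d) (hw : ∀ x ∈ Set.Ioo c d, 0 < w x)
    (hd : w d = 0) : 0 < u d := by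
  have hd0 : 0 < d := hc.trans_lt hcd
  have hmid : (c + d) / 2 ∈ Set.Ioo c d := ⟨by linarith, by linarith⟩
  have hne := h.fst_ne_zero hd0 hd ⟨_, hc.trans_lt hmid.1, (hw _ hmid).ne'⟩
  have h1 := deriv_nonpos_of_le_left hcd (h.hasDerivAt_snd d hd0) fun x hx =>
    hd.trans_le (hw x hx).le
  have h2 : 0 < d - ν ^ 2 / d := by
    rw [sub_pos, div_lt_iff₀ hd0]
    nlinarith
  refine lt_of_le_of_ne ?_ hne.symm
  by_contra! hneg
  nlinarith

theorem hasDerivAt_cross {a b : ℝ} {u z v w : ℝ → ℝ} (ha : IsBesselSol a u z)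
    (hb : IsBesselSol b v w) {x : ℝ} (hx : 0 < x) :
    HasDerivAt (fun x => u x * w x - z x * v x) ((b ^ 2 - a ^ 2) * (u x * v x) / x) x :=
  (((ha.hasDerivAt_fst x hx).mul (hb.hasDerivAt_snd x hx)).sub
    ((ha.hasDerivAt_snd x hx).mul (hb.hasDerivAt_fst x hx))).congr_deriv (by ring)

theorem exists_deriv_zero_of_pos {a b c d : ℝ} {u z v w : ℝ → ℝ} (hab : a < b) (h0 : 0 ≤ a)
    (hbc : b ≤ c) (hcd : c < d) (ha : IsBesselSol a u z) (hb : IsBesselSol b v w)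
    (hc0 : w c = 0) (hd0 : w d = 0) (hw : ∀ x ∈ Set.Ioo c d, 0 < w x)
    (hz : ∀ x ∈ Set.Ico c d, 0 < z x) : False := by
  have hcpos : 0 < c := by linarith
  have hdpos : 0 < d := by linarith
  have hX : ∀ x, 0 < x → z x ≠ 0 → HasDerivAt (fun x => w x ^ 2 * u x / z x - w x * v x)
      (((x ^ 2 - b ^ 2) * (v x - w x * (u x / z x)) ^ 2 +
        (b ^ 2 - a ^ 2) * (w x * (u x / z x)) ^ 2) / x) x := fun x hx hzx => by
    refine (((((hb.hasDerivAt_snd x hx).pow 2).mul (ha.hasDerivAt_fst x hx)).div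
      (ha.hasDerivAt_snd x hx) hzx).sub
        ((hb.hasDerivAt_snd x hx).mul (hb.hasDerivAt_fst x hx))).congr_deriv ?_
    simp only [Pi.mul_apply, Pi.pow_apply, Nat.cast_ofNat]
    field_simp
    ring
  have hD : ∀ x ∈ Set.Ioo c d, 0 ≤ u x * w x - z x * v x := fun x hx => by
    have h1 := le_of_hasDerivAt_nonneg hx.1.le (fun y hy => hX y (hcpos.trans_le hy.1)
      (hz y ⟨hy.1, hy.2.trans_lt hx.2⟩).ne') fun y hy => by
        have hy0 : 0 < y := hcpos.trans hy.1
        have h2 : 0 ≤ y ^ 2 - b ^ 2 := by nlinarith [hy.1]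
        have h3 : 0 ≤ b ^ 2 - a ^ 2 := by nlinarith
        positivity
    rw [hc0] at h1
    have hzx := hz x ⟨hx.1.le, hx.2⟩
    have hwx := hw x hx
    have h2 : w x ^ 2 * u x / z x - w x * v x = (u x * w x - z x * v x) * (w x / z x) := by
      field_simp
    rw [h2, zero_mul, sub_zero, zero_pow two_ne_zero, zero_mul, zero_div] at h1
    have h3 : 0 < w x / z x := by positivity
    by_contra! hneg
    nlinarith
  have hvd := hb.fst_pos_of_snd_pos_left (by linarith) (by linarith) hcpos.le hcd hw hd0
  have hDd := hasDerivAt_cross ha hb hdpos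
  have h1 := nonneg_of_forall_Ioo_left hcd hDd.continuousAt hD
  have h2 := nonneg_of_forall_Ioo_left hcd (ha.hasDerivAt_snd d hdpos).continuousAt
    fun x hx => (hz x ⟨hx.1.le, hx.2⟩).le
  have hzd : z d = 0 := by
    rw [hd0] at h1
    nlinarith
  have hud := ha.fst_pos_of_snd_pos_left h0 (by linarith) hcpos.le hcd
    (fun x hx => hz x ⟨hx.1.le, hx.2⟩) hzd
  have h3 := deriv_nonpos_of_le_left hcd hDd fun x hx => by
    simpa [hd0, hzd] using hD x hx
  have h4 : 0 < b ^ 2 - a ^ 2 := by nlinarith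
  exact h3.not_gt (by positivity)

/-- Sturm comparison for critical points of solutions of Bessel's equation. -/
theorem exists_deriv_zero {a b c d : ℝ} {u z v w : ℝ → ℝ} (hab : a < b) (h0 : 0 ≤ a)
    (hbc : b ≤ c) (hcd : c < d) (ha : IsBesselSol a u z) (hb : IsBesselSol b v w)
    (hc0 : w c = 0) (hd0 : w d = 0) (hw : ∀ x ∈ Set.Ioo c d, w x ≠ 0) :
    ∃ x, c ≤ x ∧ x < d ∧ z x = 0 := by
  by_contra! hcon
  have hcpos : 0 < c := by linarith
  rcases forall_pos_or_forall_neg Set.ordConnected_Ioo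
      (hb.continuousOn_snd.mono fun x hx => hcpos.trans hx.1) hw with hw' | hw' <;>
    rcases forall_pos_or_forall_neg Set.ordConnected_Ico
      (ha.continuousOn_snd.mono fun x hx => hcpos.trans_le hx.1)
      (fun x hx => hcon x hx.1 hx.2) with hz' | hz'
  · exact exists_deriv_zero_of_pos hab h0 hbc hcd ha hb hc0 hd0 hw' hz'
  · exact exists_deriv_zero_of_pos hab h0 hbc hcd ha.neg hb hc0 hd0 hw'
      fun x hx => neg_pos.2 (hz' x hx)
  · exact exists_deriv_zero_of_pos hab h0 hbc hcd ha hb.neg (by simp [hc0]) (by simp [hd0])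
      (fun x hx => neg_pos.2 (hw' x hx)) hz'
  · exact exists_deriv_zero_of_pos hab h0 hbc hcd ha.neg hb.neg (by simp [hc0]) (by simp [hd0])
      (fun x hx => neg_pos.2 (hw' x hx)) fun x hx => neg_pos.2 (hz' x hx)

theorem lt_of_interlace {f : ℝ → ℝ} {p q : ℕ → ℝ} (hp : ∀ s t, 1 ≤ s → s < t → p s < p t)
    (hpc : ∀ x, 0 < x → f x = 0 → ∃ s, 1 ≤ s ∧ p s = x) (hq : ∀ s, 1 ≤ s → 0 < q s)
    (h1 : p 1 < q 1)
    (hstep : ∀ s, 1 ≤ s → ∃ x, q s ≤ x ∧ x < q (s + 1) ∧ f x = 0) :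
    ∀ s, 1 ≤ s → p s < q s := by
  intro s hs
  induction s, hs using Nat.le_induction with
  | base => exact h1
  | succ s hs ih =>
    obtain ⟨x, hx1, hx2, hx0⟩ := hstep s hs
    obtain ⟨t, ht, rfl⟩ := hpc x ((hq s hs).trans_le hx1) hx0
    have hst : s < t := by
      by_contra! hts
      rcases hts.eq_or_lt with rfl | hts
      · exact ih.not_ge hx1
      · exact ((hp t s ht hts).trans ih).not_ge hx1
    rcases (Nat.succ_le_of_lt hst).eq_or_lt with h | h
    · exact (congrArg p h).trans_lt hx2
    · exact (hp (s + 1) t (by omega) h).trans hx2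

theorem IsPosZeroSeq.first_le {f : ℝ → ℝ} {p : ℕ → ℝ} (hp : IsPosZeroSeq f p) {x : ℝ}
    (hx : 0 < x) (hfx : f x = 0) : p 1 ≤ x := by
  obtain ⟨t, ht, rfl⟩ := hp.complete x hx hfx
  rcases ht.eq_or_lt with rfl | h
  · exact le_rfl
  · exact (hp.mono 1 t le_rfl h).le

theorem IsPosZeroSeq.ne_zero_of_lt_first {f : ℝ → ℝ} {p : ℕ → ℝ} (hp : IsPosZeroSeq f p) {x : ℝ}
    (hx : 0 < x) (hx1 : x < p 1) : f x ≠ 0 := fun h => (hp.first_le hx h).not_gt hx1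

theorem IsPosZeroSeq.ne_zero_of_mem_Ioo {f : ℝ → ℝ} {p : ℕ → ℝ} (hp : IsPosZeroSeq f p) {s : ℕ}
    (hs : 1 ≤ s) {x : ℝ} (hx : x ∈ Set.Ioo (p s) (p (s + 1))) : f x ≠ 0 := fun h => by
  obtain ⟨t, ht, rfl⟩ := hp.complete x ((hp.pos s hs).trans hx.1) h
  rcases lt_or_ge s t with h1 | h1
  · rcases (Nat.succ_le_of_lt h1).eq_or_lt with h2 | h2
    · exact hx.2.ne (by rw [← h2])
    · exact (hp.mono _ _ (by omega) h2).not_gt hx.2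
  · rcases h1.eq_or_lt with rfl | h1
    · exact hx.1.false
    · exact (hp.mono _ _ ht h1).not_gt hx.1

theorem IsPosZeroSeq.congr {f g : ℝ → ℝ} {p : ℕ → ℝ} (hp : IsPosZeroSeq f p)
    (h : ∀ x, 0 < x → (f x = 0 ↔ g x = 0)) : IsPosZeroSeq g p where
  pos := hp.pos
  mono := hp.mono
  isZero s hs := (h _ (hp.pos s hs)).1 (hp.isZero s hs)
  complete x hx hg := hp.complete x hx ((h x hx).2 hg)

/-- Interlacing of the zeros of `w` and of `v` when `(u, w)` and `(v, z)` have constant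
Wronskian `κ` and `u² + v²` is strictly decreasing. -/
theorem zeroSeq_lt_of_wronskian {u w v z : ℝ → ℝ} {κ : ℝ} {p q : ℕ → ℝ}
    (hw : ContinuousOn w (Set.Ioi 0)) (hv : ∀ x, 0 < x → HasDerivAt v (z x / x) x) (hκ : κ ≠ 0)
    (hW : ∀ x, 0 < x → u x * z x - w x * v x = κ) (hn : ∀ x, 0 < x → u x * w x + v x * z x < 0)
    (hw0 : ∀ᶠ x in nhdsWithin (0 : ℝ) (Set.Ioi 0), 0 < w x)
    (hv0 : ∀ᶠ x in nhdsWithin (0 : ℝ) (Set.Ioi 0), 0 < -κ * v x)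
    (hp : IsPosZeroSeq w p) (hq : IsPosZeroSeq v q) : ∀ s, 1 ≤ s → p s < q s := by
  have hvc : ContinuousOn v (Set.Ioi 0) := fun x hx => (hv x hx).continuousAt.continuousWithinAt
  have key : ∀ x, 0 < x → v x = 0 → κ * z x * w x < 0 := fun x hx h => by
    have h1 := hW x hx
    have h2 := hn x hx
    rw [h] at h1 h2
    have hz : z x ≠ 0 := fun hz => hκ (by rw [← h1, hz]; ring)
    have h3 : κ * z x * w x = (u x * w x) * z x ^ 2 := by rw [← h1]; ring
    rw [h3]
    exact mul_neg_of_neg_of_pos (by linarith) (by positivity)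
  refine lt_of_interlace hp.mono hp.complete hq.pos ?_ fun s hs => ?_
  · have hq1 := hq.pos 1 le_rfl
    have hpos := forall_pos_of_eventually_pos (s := Set.Ioo 0 (q 1)) Set.ordConnected_Ioo
      (fun x hx => hx.1) (Ioo_mem_nhdsGT hq1) (hvc.const_smul (-κ)) hv0
      fun x hx => mul_ne_zero (neg_ne_zero.2 hκ) (hq.ne_zero_of_lt_first hx.1 hx.2)
    have h1 := deriv_nonpos_of_le_left hq1 ((hv _ hq1).const_mul (-κ)) fun x hx => by
      rw [hq.isZero 1 le_rfl, mul_zero]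
      exact (hpos x hx).le
    have h2 := key _ hq1 (hq.isZero 1 le_rfl)
    have h3 : 0 ≤ κ * z (q 1) := by
      rw [neg_mul, neg_nonpos, ← mul_div_assoc] at h1
      by_contra! hneg
      exact (div_neg_of_neg_of_pos hneg hq1).not_ge h1
    have h4 : w (q 1) < 0 := by
      by_contra! h
      exact h2.not_ge (mul_nonneg h3 h)
    obtain ⟨c, hc, hcq, hwc, -⟩ := exists_first_zero hq1 hw hw0 h4.le
    refine (hp.first_le hc hwc).trans_lt (lt_of_le_of_ne hcq ?_)
    rintro rfl
    exact h4.ne hwc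
  · have hqs := hq.pos s hs
    have hlt := hq.mono s (s + 1) hs (Nat.lt_succ_self s)
    have hqs' := hqs.trans hlt
    have h1 := deriv_mul_deriv_nonpos hlt (fun x hx => hv x (hqs.trans_le hx.1))
      (hq.isZero s hs) (hq.isZero _ (by omega)) fun x hx => hq.ne_zero_of_mem_Ioo hs hx
    have h2 := key _ hqs (hq.isZero s hs)
    have h3 := key _ hqs' (hq.isZero _ (by omega))
    have h4 : z (q s) * z (q (s + 1)) ≤ 0 := by
      rw [div_mul_div_comm] at h1
      by_contra! h
      exact h1.not_gt (div_pos h (mul_pos hqs hqs'))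
    by_contra! hcon
    have hne : ∀ x ∈ Set.Icc (q s) (q (s + 1)), w x ≠ 0 := fun x hx => by
      rcases hx.2.eq_or_lt with rfl | h
      · intro h
        rw [h, mul_zero] at h3
        exact h3.false
      · exact hcon x hx.1 h
    have hmul : 0 < w (q s) * w (q (s + 1)) := by
      rcases forall_pos_or_forall_neg Set.ordConnected_Icc
        (hw.mono fun x hx => hqs.trans_le hx.1) hne with h | h
      · exact mul_pos (h _ (Set.left_mem_Icc.2 hlt.le)) (h _ (Set.right_mem_Icc.2 hlt.le))
      · exact mul_pos_of_neg_of_neg (h _ (Set.left_mem_Icc.2 hlt.le))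
          (h _ (Set.right_mem_Icc.2 hlt.le))
    have h5 := mul_pos_of_neg_of_neg h2 h3
    have h6 : κ * z (q s) * w (q s) * (κ * z (q (s + 1)) * w (q (s + 1))) =
        (z (q s) * z (q (s + 1))) * (κ ^ 2 * (w (q s) * w (q (s + 1)))) := by ring
    rw [h6] at h5
    exact h5.not_ge (mul_nonpos_of_nonpos_of_nonneg h4 (by positivity))

theorem eventually_hankelRe_pos {ν : ℝ} (hν : 0 ≤ ν) :
    ∀ᶠ x in nhdsWithin (0 : ℝ) (Set.Ioi 0), 0 < hankelRe ν x := by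
  filter_upwards [eventually_besselJ_pos (by linarith : -1 < ν), self_mem_nhdsWithin] with x hx hx0
  rwa [hankelRe_eq_besselJ ν hx0]

theorem tendsto_hankelRe_zero {ν : ℝ} (hν : 0 < ν) :
    Tendsto (hankelRe ν) (nhdsWithin 0 (Set.Ioi 0)) (nhds 0) := by
  refine (tendsto_besselJ_zero hν).congr' ?_
  filter_upwards [self_mem_nhdsWithin] with x hx
  rw [hankelRe_eq_besselJ ν hx]

theorem tendsto_hankelReDer_zero {ν : ℝ} (hν : 0 < ν) :
    Tendsto (hankelReDer ν) (nhdsWithin 0 (Set.Ioi 0)) (nhds 0) := by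
  have hx : Tendsto (fun x : ℝ => x) (nhdsWithin 0 (Set.Ioi 0)) (nhds 0) :=
    tendsto_id.mono_left nhdsWithin_le_nhds
  have := ((tendsto_hankelRe_zero hν).const_mul ν).sub
    (hx.mul (tendsto_hankelRe_zero (by linarith : 0 < ν + 1)))
  rwa [mul_zero, mul_zero, sub_zero] at this

theorem nonneg_of_tendsto_zero {f f' : ℝ → ℝ} {d : ℝ} (hd : 0 < d)
    (h0 : Tendsto f (nhdsWithin 0 (Set.Ioi 0)) (nhds 0))
    (hf : ∀ x, 0 < x → HasDerivAt f (f' x) x) (hf' : ∀ x ∈ Set.Ioo 0 d, 0 ≤ f' x) : 0 ≤ f d := by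
  refine le_of_tendsto h0 ?_
  filter_upwards [Ioo_mem_nhdsGT hd] with x hx
  exact le_of_hasDerivAt_nonneg hx.2.le (fun y hy => hf y (hx.1.trans_le hy.1))
    fun y hy => hf' y ⟨hx.1.trans hy.1, hy.2⟩

theorem hankelRe_mul_hankelReDer_pos {ν x : ℝ} (hν : 0 < ν) (hx : 0 < x) (hxν : x ≤ ν) :
    0 < hankelRe ν x * hankelReDer ν x := by
  have hA := isBesselSol_hankelRe ν
  have hlim := (tendsto_hankelRe_zero hν).mul (tendsto_hankelReDer_zero hν)
  rw [mul_zero] at hlim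
  have hd : ∀ y, 0 < y → HasDerivAt (fun x => hankelRe ν x * hankelReDer ν x)
      ((hankelReDer ν y ^ 2 + (ν ^ 2 - y ^ 2) * hankelRe ν y ^ 2) / y) y := fun y hy => by
    refine ((hA.hasDerivAt_fst y hy).mul (hA.hasDerivAt_snd y hy)).congr_deriv ?_
    field_simp
    ring
  obtain ⟨r, hr, hrf⟩ := (mem_nhdsGT_iff_exists_Ioc_subset).1 (eventually_hankelRe_pos hν.le)
  have hr0 : (0 : ℝ) < r := hr
  set t := min r x with ht
  have ht0 : 0 < t := lt_min hr hx
  have h1 := nonneg_of_tendsto_zero (half_pos ht0) hlim hd fun y hy => by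
    have hy0 := hy.1
    have : y < t := hy.2.trans (half_lt_self ht0)
    have hyν : y < ν := this.trans_le ((min_le_right _ _).trans hxν)
    have : 0 < ν ^ 2 - y ^ 2 := by nlinarith
    positivity
  have h2 := lt_of_hasDerivAt_pos (half_lt_self ht0)
    (fun y hy => hd y ((half_pos ht0).trans_le hy.1)) fun y hy => by
      have hy0 : 0 < y := (half_pos ht0).trans hy.1
      have hyν : y < ν := hy.2.trans_le ((min_le_right _ _).trans hxν)
      have h3 : 0 < ν ^ 2 - y ^ 2 := by nlinarith
      have h4 : 0 < hankelRe ν y := hrf ⟨hy0, (hy.2.trans_le (min_le_left _ _)).le⟩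
      positivity
  have h3 := le_of_hasDerivAt_nonneg (min_le_right r x)
    (fun y hy => hd y (ht0.trans_le hy.1)) fun y hy => by
      have hy0 : 0 < y := ht0.trans hy.1
      have hyν : y < ν := hy.2.trans_le hxν
      have : 0 < ν ^ 2 - y ^ 2 := by nlinarith
      positivity
  exact (h1.trans_lt h2).trans_le h3

theorem hankelIm_mul_hankelImDer_neg {ν x : ℝ} (hν : 0 < ν) (hx : 0 < x) (hxν : x ≤ ν) :
    hankelIm ν x * hankelImDer ν x < 0 := by
  have h1 := hankelRe_mul_hankelReDer_pos hν hx hxν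
  have h2 := hankelModDer_neg hν hx
  rw [hankelModDer] at h2
  linarith

theorem eventually_hankelReDer_pos {ν : ℝ} (hν : 0 < ν) :
    ∀ᶠ x in nhdsWithin (0 : ℝ) (Set.Ioi 0), 0 < hankelReDer ν x := by
  filter_upwards [eventually_hankelRe_pos hν.le, Ioc_mem_nhdsGT hν] with x hx hx'
  exact (mul_pos_iff_of_pos_left hx).1 (hankelRe_mul_hankelReDer_pos hν hx'.1 hx'.2)

theorem eventually_hankelRe_le {ν : ℝ} (hν : 0 ≤ ν) :
    ∃ M : ℝ, ∀ᶠ x in nhdsWithin (0 : ℝ) (Set.Ioi 0), hankelRe ν x ≤ M := by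
  rcases hν.eq_or_lt with rfl | hν
  · refine ⟨(Real.Gamma (0 + 1))⁻¹ + 1, ?_⟩
    filter_upwards [(tendsto_besselEntire_sq 0).eventually_le_const (lt_add_one _),
      self_mem_nhdsWithin] with x hx hx0
    rw [hankelRe_eq_besselJ 0 hx0, besselJ_eq 0 hx0, Real.rpow_zero, one_mul]
    exact hx
  · exact ⟨1, (tendsto_hankelRe_zero hν).eventually_le_const one_pos⟩

theorem hasDerivAt_hankelIm_div_hankelRe (ν : ℝ) {x : ℝ} (hx : 0 < x) (h : hankelRe ν x ≠ 0) :
    HasDerivAt (fun x => hankelIm ν x / hankelRe ν x) (2 / π / (x * hankelRe ν x ^ 2)) x := by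
  refine (((isBesselSol_hankelIm ν).hasDerivAt_fst x hx).div
    ((isBesselSol_hankelRe ν).hasDerivAt_fst x hx) h).congr_deriv ?_
  rw [← hankel_wronskian ν hx]
  field_simp

theorem tendsto_hankelIm_div_hankelRe {ν : ℝ} (hν : 0 ≤ ν) :
    Tendsto (fun x => hankelIm ν x / hankelRe ν x) (nhdsWithin 0 (Set.Ioi 0)) atBot := by
  obtain ⟨M, hM⟩ := eventually_hankelRe_le hν
  obtain ⟨r, hr, hrf⟩ := (mem_nhdsGT_iff_exists_Ioc_subset).1
    ((eventually_hankelRe_pos hν).and hM)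
  have hr0 : (0 : ℝ) < r := hr
  have hM0 : 0 < M := (hrf ⟨hr0, le_rfl⟩).1.trans_le (hrf ⟨hr0, le_rfl⟩).2
  have hlog := (tendsto_atBot_add_const_left _
    (hankelIm ν r / hankelRe ν r - 2 / π / M ^ 2 * Real.log r)
      (Real.tendsto_log_nhdsGT_zero.const_mul_atBot (by positivity : 0 < 2 / π / M ^ 2)))
  refine tendsto_atBot_mono' _ ?_ hlog
  filter_upwards [Ioc_mem_nhdsGT hr0] with x hx
  have := le_of_hasDerivAt_nonneg (f := fun y => hankelIm ν y / hankelRe ν y -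
    2 / π / M ^ 2 * Real.log y) hx.2 (fun y hy =>
      (hasDerivAt_hankelIm_div_hankelRe ν (hx.1.trans_le hy.1)
        (hrf ⟨hx.1.trans_le hy.1, hy.2⟩).1.ne').sub
          ((Real.hasDerivAt_log (hx.1.trans_le hy.1).ne').const_mul _)) fun y hy => by
    have hy0 : 0 < y := hx.1.trans hy.1
    obtain ⟨h1, h2⟩ := hrf ⟨hy0, hy.2.le⟩
    have h1' : 0 < hankelRe ν y := h1
    have h3 : hankelRe ν y ^ 2 ≤ M ^ 2 := pow_le_pow_left₀ h1'.le h2 2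
    have e : 2 / π / (y * hankelRe ν y ^ 2) - 2 / π / M ^ 2 * y⁻¹ =
        2 / π / y * (M ^ 2 - hankelRe ν y ^ 2) / (hankelRe ν y ^ 2 * M ^ 2) := by
      field_simp
    rw [e]
    have := sub_nonneg.2 h3
    positivity
  linarith

theorem eventually_hankelIm_neg {ν : ℝ} (hν : 0 ≤ ν) :
    ∀ᶠ x in nhdsWithin (0 : ℝ) (Set.Ioi 0), hankelIm ν x < 0 := by
  filter_upwards [(tendsto_hankelIm_div_hankelRe hν).eventually_lt_atBot 0,
    eventually_hankelRe_pos hν] with x h1 h2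
  rw [div_neg_iff] at h1
  rcases h1 with h1 | h1
  · exact absurd h1.2 h2.not_gt
  · exact h1.1

theorem eventually_hankelImDer_pos {ν : ℝ} (hν : 0 ≤ ν) :
    ∀ᶠ x in nhdsWithin (0 : ℝ) (Set.Ioi 0), 0 < hankelImDer ν x := by
  rcases hν.eq_or_lt with rfl | hν
  · filter_upwards [eventually_hankelIm_neg le_rfl, eventually_hankelRe_pos le_rfl,
      eventually_hankelRe_pos (ν := 0 + 1) (by norm_num), self_mem_nhdsWithin] with x h1 h2 h3 hx
    have hx0 : 0 < x := hx
    have hW := hankel_wronskian 0 hx0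
    have h4 : 0 < 2 / π := by positivity
    have h5 : hankelReDer 0 x < 0 := by
      rw [hankelReDer, zero_mul, zero_sub, neg_neg_iff_pos]
      positivity
    by_contra! h
    nlinarith [mul_pos_of_neg_of_neg h5 h1]
  · filter_upwards [eventually_hankelIm_neg hν.le, Ioc_mem_nhdsGT hν] with x hx hx'
    have := hankelIm_mul_hankelImDer_neg hν hx'.1 hx'.2
    by_contra! h
    nlinarith

theorem IsBesselSol.fst_pos_of_snd_pos {ν d : ℝ} {u w : ℝ → ℝ} (h : IsBesselSol ν u w)
    (h0 : ∀ᶠ x in nhdsWithin (0 : ℝ) (Set.Ioi 0), 0 < u x) (hw : ∀ x ∈ Set.Ioo 0 d, 0 < w x) :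
    ∀ x ∈ Set.Ioc 0 d, 0 < u x := fun x hx => by
  obtain ⟨y, hy, hyx⟩ := (h0.and (Ioo_mem_nhdsGT hx.1)).exists
  refine hy.trans_le (le_of_hasDerivAt_nonneg hyx.2.le
    (fun t ht => h.hasDerivAt_fst t (hyx.1.trans_le ht.1)) fun t ht => ?_)
  have ht0 := hyx.1.trans ht.1
  exact (div_pos (hw t ⟨ht0, ht.2.trans_le hx.2⟩) ht0).le

/-- The first critical point of `J_a` precedes that of `J_b` for `0 < a < b`. -/
theorem exists_hankelReDer_zero {a b d : ℝ} (ha : 0 < a) (hab : a < b) (hd : 0 < d)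
    (hd0 : hankelReDer b d = 0) (hb : ∀ x ∈ Set.Ioo 0 d, hankelReDer b x ≠ 0) :
    ∃ x ∈ Set.Ioo 0 d, hankelReDer a x = 0 := by
  by_contra! hcon
  have hb0 := ha.trans hab
  have hA := isBesselSol_hankelRe a
  have hB := isBesselSol_hankelRe b
  have hwa := forall_pos_of_eventually_pos Set.ordConnected_Ioo (fun x hx => hx.1)
    (Ioo_mem_nhdsGT hd) hA.continuousOn_snd (eventually_hankelReDer_pos ha) hcon
  have hwb := forall_pos_of_eventually_pos Set.ordConnected_Ioo (fun x hx => hx.1)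
    (Ioo_mem_nhdsGT hd) hB.continuousOn_snd (eventually_hankelReDer_pos hb0) hb
  have hua := hA.fst_pos_of_snd_pos (eventually_hankelRe_pos ha.le) hwa
  have hub := hB.fst_pos_of_snd_pos (eventually_hankelRe_pos hb0.le) hwb
  have hδ : 0 < b ^ 2 - a ^ 2 := by nlinarith
  have hlim := ((tendsto_hankelRe_zero ha).mul (tendsto_hankelReDer_zero hb0)).sub
    ((tendsto_hankelReDer_zero ha).mul (tendsto_hankelRe_zero hb0))
  rw [mul_zero, sub_zero] at hlim
  have hpos : ∀ x ∈ Set.Ioo 0 d,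
      0 < (b ^ 2 - a ^ 2) * (hankelRe a x * hankelRe b x) / x := fun x hx => by
    have h1 := hua x ⟨hx.1, hx.2.le⟩
    have h2 := hub x ⟨hx.1, hx.2.le⟩
    have := hx.1
    positivity
  have h1 := nonneg_of_tendsto_zero (half_pos hd) hlim (fun x hx => hasDerivAt_cross hA hB hx)
    fun x hx => (hpos x ⟨hx.1, hx.2.trans (half_lt_self hd)⟩).le
  have h2 := lt_of_hasDerivAt_pos (half_lt_self hd)
    (fun x hx => hasDerivAt_cross hA hB ((half_pos hd).trans_le hx.1))
    fun x hx => hpos x ⟨(half_pos hd).trans hx.1, hx.2⟩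
  have h3 := nonneg_of_forall_Ioo_left hd (hA.hasDerivAt_snd d hd).continuousAt
    fun x hx => (hwa x hx).le
  have h4 := hub d ⟨hd, le_rfl⟩
  rw [hd0] at h2
  nlinarith

theorem hasDerivAt_arctan_hankel (ν : ℝ) {x : ℝ} (hx : 0 < x) (h : hankelRe ν x ≠ 0) :
    HasDerivAt (fun x => Real.arctan (hankelIm ν x / hankelRe ν x))
      (2 / π / x * (hankelMod ν x)⁻¹) x := by
  refine (hasDerivAt_hankelIm_div_hankelRe ν hx h).arctan.congr_deriv ?_
  rw [hankelMod]
  have : 0 < hankelRe ν x ^ 2 + hankelIm ν x ^ 2 := by positivity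
  field_simp

theorem exists_hankelIm_pos {a b e : ℝ} (ha : 0 ≤ a) (hab : a < b) (he : 0 < e)
    (hb : ∀ x ∈ Set.Ioc 0 e, 0 < hankelRe b x) (hbe : hankelIm b e = 0) :
    ∃ x ∈ Set.Ioc 0 e, 0 < hankelIm a x := by
  by_contra! hcon
  have hA := isBesselSol_hankelRe a
  have ha' : ∀ x ∈ Set.Ioc 0 e, 0 < hankelRe a x := by
    by_contra! h
    obtain ⟨t, ht, hta⟩ := h
    obtain ⟨c, hc, hct, hca, hlt⟩ := exists_first_zero ht.1 hA.continuousOn_fst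
      (eventually_hankelRe_pos ha) hta
    have h1 := deriv_nonpos_of_le_left hc (hA.hasDerivAt_fst c hc) fun x hx => by
      rw [hca]
      exact (hlt x hx).le
    have h2 := hankel_wronskian a hc
    rw [hca, zero_mul, zero_sub] at h2
    have h3 := hcon c ⟨hc, hct.trans ht.2⟩
    have h4 : hankelReDer a c ≤ 0 := by
      by_contra! h
      exact h1.not_gt (div_pos h hc)
    have h5 : 0 < 2 / π := by positivity
    nlinarith [mul_nonneg_of_nonpos_of_nonpos h4 h3]
  have hlim : ∀ ν : ℝ, 0 ≤ ν → Tendsto (fun x => Real.arctan (hankelIm ν x / hankelRe ν x))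
      (nhdsWithin 0 (Set.Ioi 0)) (nhds (-(π / 2))) := fun ν hν =>
    (Real.tendsto_arctan_atBot.mono_right nhdsWithin_le_nhds).comp
      (tendsto_hankelIm_div_hankelRe hν)
  have hl := (hlim a ha).sub (hlim b (ha.trans hab.le))
  rw [sub_self] at hl
  have hd : ∀ x ∈ Set.Ioc 0 e, HasDerivAt (fun x => Real.arctan (hankelIm a x / hankelRe a x) -
      Real.arctan (hankelIm b x / hankelRe b x))
      (2 / π / x * (hankelMod a x)⁻¹ - 2 / π / x * (hankelMod b x)⁻¹) x := fun x hx =>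
    (hasDerivAt_arctan_hankel a hx.1 (ha' x hx).ne').sub
      (hasDerivAt_arctan_hankel b hx.1 (hb x hx).ne')
  have hd' : ∀ x ∈ Set.Ioc 0 e,
      0 < 2 / π / x * (hankelMod a x)⁻¹ - 2 / π / x * (hankelMod b x)⁻¹ := fun x hx => by
    have hx0 := hx.1
    have h1 : 0 < hankelMod a x := by
      have := ha' x hx
      unfold hankelMod
      positivity
    have h2 := inv_strictAnti₀ h1 (hankelMod_lt_hankelMod ha hab hx0)
    rw [← mul_sub]
    exact mul_pos (by positivity) (sub_pos.2 h2)
  have h1 : 0 ≤ Real.arctan (hankelIm a (e / 2) / hankelRe a (e / 2)) -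
      Real.arctan (hankelIm b (e / 2) / hankelRe b (e / 2)) := by
    refine le_of_tendsto hl ?_
    filter_upwards [Ioo_mem_nhdsGT (half_pos he)] with x hx
    have hs : ∀ y, x ≤ y → y ≤ e / 2 → y ∈ Set.Ioc 0 e := fun y h1 h2 =>
      ⟨hx.1.trans_le h1, h2.trans (half_lt_self he).le⟩
    exact le_of_hasDerivAt_nonneg hx.2.le (fun y hy => hd y (hs y hy.1 hy.2))
      fun y hy => (hd' y (hs y hy.1.le hy.2.le)).le
  have h2 := lt_of_hasDerivAt_pos (half_lt_self he)
    (fun y hy => hd y ⟨(half_pos he).trans_le hy.1, hy.2⟩)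
    fun y hy => hd' y ⟨(half_pos he).trans hy.1, hy.2.le⟩
  have h3 := h1.trans_lt h2
  rw [hbe, zero_div, Real.arctan_zero, sub_zero, ← Real.arctan_zero,
    Real.arctan_strictMono.lt_iff_lt] at h3
  have he' := ha' e ⟨he, le_rfl⟩
  exact (hcon e ⟨he, le_rfl⟩).not_gt ((div_pos_iff_of_pos_right he').1 h3)

/-- The first critical point of `Y_a` precedes that of `Y_b` for `0 ≤ a < b`. -/
theorem exists_hankelImDer_zero {a b d : ℝ} (ha : 0 ≤ a) (hab : a < b) (hd : 0 < d)
    (hd0 : hankelImDer b d = 0) (hb : ∀ x ∈ Set.Ioo 0 d, hankelImDer b x ≠ 0)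
    (hRe : ∀ x ∈ Set.Ioc 0 d, hankelRe b x ≠ 0) :
    ∃ x ∈ Set.Ioo 0 d, hankelImDer a x = 0 := by
  by_contra! hcon
  have hb0 := ha.trans_lt hab
  have hA := isBesselSol_hankelIm a
  have hB := isBesselSol_hankelIm b
  have hwa := forall_pos_of_eventually_pos Set.ordConnected_Ioo (fun x hx => hx.1)
    (Ioo_mem_nhdsGT hd) hA.continuousOn_snd (eventually_hankelImDer_pos ha) hcon
  have hwb := forall_pos_of_eventually_pos Set.ordConnected_Ioo (fun x hx => hx.1)
    (Ioo_mem_nhdsGT hd) hB.continuousOn_snd (eventually_hankelImDer_pos hb0.le) hb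
  have hJ := forall_pos_of_eventually_pos Set.ordConnected_Ioc (fun x hx => hx.1)
    (Ioc_mem_nhdsGT hd) (isBesselSol_hankelRe b).continuousOn_fst
    (eventually_hankelRe_pos hb0.le) hRe
  have hYd : 0 < hankelIm b d := by
    have h1 := hankel_wronskian b hd
    have h2 := hankelModDer_neg hb0 hd
    rw [hankelModDer] at h2
    rw [hd0, mul_zero] at h1 h2
    have h3 : 0 < 2 / π := by positivity
    have h4 := hJ d ⟨hd, le_rfl⟩
    have h5 : hankelReDer b d < 0 := by
      by_contra! h
      nlinarith
    by_contra! h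
    nlinarith
  obtain ⟨e, he, hed, hbe, -⟩ := exists_first_zero hd hB.neg.continuousOn_fst
    ((eventually_hankelIm_neg hb0.le).mono fun x hx => neg_pos.2 hx) (neg_nonpos.2 hYd.le)
  rw [neg_eq_zero] at hbe
  have hed' : e < d := lt_of_le_of_ne hed fun h => hYd.ne' (h ▸ hbe)
  obtain ⟨x, hx, hxa⟩ := exists_hankelIm_pos ha hab he
    (fun x hx => hJ x ⟨hx.1, hx.2.trans hed⟩) hbe
  have hmono : ∀ {ν : ℝ} {s t : ℝ}, (∀ x ∈ Set.Ioo 0 d, 0 < hankelImDer ν x) → 0 < s → s ≤ t →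
      t ≤ d → hankelIm ν s ≤ hankelIm ν t := fun {ν s t} hν hs hst htd =>
    le_of_hasDerivAt_nonneg hst
      (fun y hy => (isBesselSol_hankelIm ν).hasDerivAt_fst y (hs.trans_le hy.1)) fun y hy =>
        (div_pos (hν y ⟨hs.trans hy.1, hy.2.trans_le htd⟩) (hs.trans hy.1)).le
  have hae : 0 < hankelIm a e := hxa.trans_le (hmono hwa hx.1 hx.2 hed)
  have h1 := le_of_hasDerivAt_nonneg hed (fun y hy => hasDerivAt_cross hA hB (he.trans_le hy.1))
    fun y hy => by
      have hy0 : 0 < y := he.trans hy.1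
      have h2 : 0 < hankelIm a y := hae.trans_le (hmono hwa he hy.1.le hy.2.le)
      have h3 : 0 ≤ hankelIm b y := hbe.symm.le.trans (hmono hwb he hy.1.le hy.2.le)
      have h4 : 0 < b ^ 2 - a ^ 2 := by nlinarith
      positivity
  rw [hbe, hd0, mul_zero, mul_zero, sub_zero, zero_sub] at h1
  have h2 := hwb e ⟨he, hed'⟩
  have h3 := nonneg_of_forall_Ioo_left hd (hA.hasDerivAt_snd d hd).continuousAt
    fun x hx => (hwa x hx).le
  nlinarith [mul_pos hae h2, mul_nonneg h3 hYd.le]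

theorem deriv_besselJ_eq_zero_iff (ν : ℝ) {x : ℝ} (hx : 0 < x) :
    deriv (besselJ ν) x = 0 ↔ hankelReDer ν x = 0 := by
  have h : HasDerivAt (besselJ ν) (hankelReDer ν x / x) x :=
    ((isBesselSol_hankelRe ν).hasDerivAt_fst x hx).congr_of_eventuallyEq (by
      filter_upwards [Ioi_mem_nhds hx] with y hy using (hankelRe_eq_besselJ ν hy).symm)
  rw [h.deriv, div_eq_zero_iff, or_iff_left hx.ne']

theorem deriv_besselY_eq_zero_iff (ν : ℝ) {x : ℝ} (hx : 0 < x) :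
    deriv (besselY ν) x = 0 ↔ hankelImDer ν x = 0 := by
  have h : HasDerivAt (besselY ν) (hankelImDer ν x / x) x :=
    ((isBesselSol_hankelIm ν).hasDerivAt_fst x hx).congr_of_eventuallyEq (by
      filter_upwards [Ioi_mem_nhds hx] with y hy using (hankelIm_eq_besselY ν hy).symm)
  rw [h.deriv, div_eq_zero_iff, or_iff_left hx.ne']

theorem hankelReDer_zeroSeq_lt {b : ℝ} (hb : 0 < b) {p q : ℕ → ℝ}
    (hp : IsPosZeroSeq (hankelReDer b) p) (hq : IsPosZeroSeq (hankelIm b) q) :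
    ∀ s, 1 ≤ s → p s < q s := by
  have hκ : 0 < 2 / π := by positivity
  refine zeroSeq_lt_of_wronskian (isBesselSol_hankelRe b).continuousOn_snd
    (isBesselSol_hankelIm b).hasDerivAt_fst hκ.ne' (fun x hx => hankel_wronskian b hx)
    (fun x hx => hankelModDer_neg hb hx) (eventually_hankelReDer_pos hb) ?_ hp hq
  filter_upwards [eventually_hankelIm_neg hb.le] with x hx
  nlinarith

theorem hankelImDer_zeroSeq_lt {b : ℝ} (hb : 0 < b) {p q : ℕ → ℝ}
    (hp : IsPosZeroSeq (hankelImDer b) p) (hq : IsPosZeroSeq (hankelRe b) q) :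
    ∀ s, 1 ≤ s → p s < q s := by
  have hκ : 0 < 2 / π := by positivity
  refine zeroSeq_lt_of_wronskian (u := hankelIm b) (z := hankelReDer b) (κ := -(2 / π))
    (isBesselSol_hankelIm b).continuousOn_snd (isBesselSol_hankelRe b).hasDerivAt_fst
    (neg_ne_zero.2 hκ.ne') (fun x hx => ?_) (fun x hx => ?_) (eventually_hankelImDer_pos hb.le)
    ?_ hp hq
  · rw [← hankel_wronskian b hx]
    ring
  · have := hankelModDer_neg hb hx
    rw [hankelModDer] at this
    linarith
  · filter_upwards [eventually_hankelRe_pos hb.le] with x hx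
    rw [neg_neg]
    positivity

theorem lt_of_hankelReDer_eq_zero {b x : ℝ} (hb : 0 < b) (hx : 0 < x)
    (h : hankelReDer b x = 0) : b < x := by
  by_contra! hxb
  have := hankelRe_mul_hankelReDer_pos hb hx hxb
  rw [h, mul_zero] at this
  exact this.false

theorem lt_of_hankelImDer_eq_zero {b x : ℝ} (hb : 0 < b) (hx : 0 < x)
    (h : hankelImDer b x = 0) : b < x := by
  by_contra! hxb
  have := hankelIm_mul_hankelImDer_neg hb hx hxb
  rw [h, mul_zero] at this
  exact this.false

theorem hankelReDer_step {a b : ℝ} (ha : 0 ≤ a) (hab : a < b) {q : ℕ → ℝ}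
    (hq : IsPosZeroSeq (hankelReDer b) q) (s : ℕ) (hs : 1 ≤ s) :
    ∃ x, q s ≤ x ∧ x < q (s + 1) ∧ hankelReDer a x = 0 :=
  exists_deriv_zero hab ha
    (lt_of_hankelReDer_eq_zero (ha.trans_lt hab) (hq.pos s hs) (hq.isZero s hs)).le
    (hq.mono _ _ hs (Nat.lt_succ_self s)) (isBesselSol_hankelRe a) (isBesselSol_hankelRe b)
    (hq.isZero s hs) (hq.isZero _ (by omega)) fun _ hx => hq.ne_zero_of_mem_Ioo hs hx

theorem hankelImDer_step {a b : ℝ} (ha : 0 ≤ a) (hab : a < b) {q : ℕ → ℝ}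
    (hq : IsPosZeroSeq (hankelImDer b) q) (s : ℕ) (hs : 1 ≤ s) :
    ∃ x, q s ≤ x ∧ x < q (s + 1) ∧ hankelImDer a x = 0 :=
  exists_deriv_zero hab ha
    (lt_of_hankelImDer_eq_zero (ha.trans_lt hab) (hq.pos s hs) (hq.isZero s hs)).le
    (hq.mono _ _ hs (Nat.lt_succ_self s)) (isBesselSol_hankelIm a) (isBesselSol_hankelIm b)
    (hq.isZero s hs) (hq.isZero _ (by omega)) fun _ hx => hq.ne_zero_of_mem_Ioo hs hx

theorem besselJDerivZeroSeq_lt {a b : ℝ} (ha : 0 ≤ a) (hab : a < b) {p q : ℕ → ℝ}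
    (hp : IsBesselJDerivZeroSeq a p) (hq : IsPosZeroSeq (hankelReDer b) q) :
    ∀ s, 1 ≤ s → p s < q s := by
  rcases ha.eq_or_lt with rfl | ha
  · obtain ⟨hp1, hp0⟩ := hp.1 rfl
    have hp0' := hp0.congr fun x hx => deriv_besselJ_eq_zero_iff 0 hx
    refine lt_of_interlace (fun s t hs hst => ?_) (fun x hx h => ?_) hq.pos ?_
      (hankelReDer_step le_rfl hab hq)
    · obtain ⟨t, rfl⟩ : ∃ k, t = k + 1 := ⟨t - 1, by omega⟩
      rcases hs.eq_or_lt with rfl | hs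
      · rw [hp1]
        exact hp0.pos t (by omega)
      · obtain ⟨s, rfl⟩ : ∃ k, s = k + 1 := ⟨s - 1, by omega⟩
        exact hp0.mono s t (by omega) (by omega)
    · obtain ⟨s, hs, rfl⟩ := hp0'.complete x hx h
      exact ⟨s + 1, by omega, rfl⟩
    · rw [hp1]
      exact hq.pos 1 le_rfl
  · have hp' := (hp.2 ha.ne').congr fun x hx => deriv_besselJ_eq_zero_iff a hx
    refine lt_of_interlace hp'.mono hp'.complete hq.pos ?_ (hankelReDer_step ha.le hab hq)
    obtain ⟨x, hx, hx0⟩ := exists_hankelReDer_zero ha hab (hq.pos 1 le_rfl) (hq.isZero 1 le_rfl)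
      fun x hx => hq.ne_zero_of_lt_first hx.1 hx.2
    exact (hp'.first_le hx.1 hx0).trans_lt hx.2

theorem hankelImDer_zeroSeq_lt_of_lt {a b : ℝ} (ha : 0 ≤ a) (hab : a < b) {p q r : ℕ → ℝ}
    (hp : IsPosZeroSeq (hankelImDer a) p) (hq : IsPosZeroSeq (hankelImDer b) q)
    (hr : IsPosZeroSeq (hankelRe b) r) : ∀ s, 1 ≤ s → p s < q s := by
  refine lt_of_interlace hp.mono hp.complete hq.pos ?_ (hankelImDer_step ha hab hq)
  have hqr := hankelImDer_zeroSeq_lt (ha.trans_lt hab) hq hr 1 le_rfl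
  obtain ⟨x, hx, hx0⟩ := exists_hankelImDer_zero ha hab (hq.pos 1 le_rfl) (hq.isZero 1 le_rfl)
    (fun x hx => hq.ne_zero_of_lt_first hx.1 hx.2)
    fun x hx => hr.ne_zero_of_lt_first hx.1 (hx.2.trans_lt hqr)
  exact (hp.first_le hx.1 hx0).trans_lt hx.2

/-- For `0 < ε ≤ 1` and `s ≥ 1`:
`j'_{ν,s} < j'_{ν+ε,s} < y_{ν+ε,s}` and `y'_{ν,s} < y'_{ν+ε,s} < j_{ν+ε,s}`. -/
theorem bessel_deriv_zeros_bounds_eps (ν ε : ℝ) (hν : 0 ≤ ν)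
    (hε : 0 < ε) (hε1 : ε ≤ 1)
    (jε yε j' jε' y' yε' : ℕ → ℝ)
    (hjε : IsPosZeroSeq (besselJ (ν + ε)) jε)
    (hyε : IsPosZeroSeq (besselY (ν + ε)) yε)
    (hj' : IsBesselJDerivZeroSeq ν j')
    (hjε' : IsBesselJDerivZeroSeq (ν + ε) jε')
    (hy' : IsPosZeroSeq (deriv (besselY ν)) y')
    (hyε' : IsPosZeroSeq (deriv (besselY (ν + ε))) yε') :
    ∀ s : ℕ, 1 ≤ s →
      (j' s < jε' s ∧ jε' s < yε s) ∧ (y' s < yε' s ∧ yε' s < jε s) := by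
  have hb : 0 < ν + ε := by linarith
  have hab : ν < ν + ε := by linarith
  have hJ := hjε.congr (g := hankelRe (ν + ε)) fun x hx => by rw [hankelRe_eq_besselJ _ hx]
  have hY := hyε.congr (g := hankelIm (ν + ε)) fun x hx => by rw [hankelIm_eq_besselY _ hx]
  have hJ' := (hjε'.2 hb.ne').congr fun x hx => deriv_besselJ_eq_zero_iff (ν + ε) hx
  have hYa' := hy'.congr fun x hx => deriv_besselY_eq_zero_iff ν hx
  have hYb' := hyε'.congr fun x hx => deriv_besselY_eq_zero_iff (ν + ε) hx
  exact fun s hs => ⟨⟨besselJDerivZeroSeq_lt hν hab hj' hJ' s hs,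
    hankelReDer_zeroSeq_lt hb hJ' hY s hs⟩,
    hankelImDer_zeroSeq_lt_of_lt hν hab hYa' hYb' hJ s hs, hankelImDer_zeroSeq_lt hb hYb' hJ s hs⟩
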